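/- arXiv:1305.1719 — 2 statements merged into one kernel-verified Lean document; each statement's English description precedes it below -/
import Mathlib

section
/- Fix an integer d ≥ n. For every s ∈ {0,1,…,n}, the module Ext^{s·(m−n)}_S(I^d, S) is nonzero. -/
open MvPolynomial

section ExtVanish

open CategoryTheory Opposite

/-- If `Ext^n(A, Y) = 0` then cocycles on a projective resolution of `A` are coboundaries. -/
theorem exists_coboundary_of_subsingleton_ext {R : Type} [CommRing R] {A Y : ModuleCat.{0} R}
    (n : ℕ) (h : Subsingleton (((Ext R (ModuleCat.{0} R) n).obj (op A)).obj Y))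
    (P : ProjectiveResolution A) (f : P.complex.X n ⟶ Y)
    (hf : P.complex.d (n + 1) n ≫ f = 0) :
    ∃ (j : ℕ) (g : P.complex.X j ⟶ Y), P.complex.d n j ≫ g = f := by
  have h0 : Limits.IsZero ((P.complex.linearYonedaObj R Y).homology n) := by
    have := ModuleCat.isZero_of_subsingleton (((Ext R (ModuleCat.{0} R) n).obj (op A)).obj Y)
    exact this.of_iso (P.isoExt n Y).symm
  rw [← HomologicalComplex.exactAt_iff_isZero_homology,
    HomologicalComplex.exactAt_iff' _ _ n (n + 1) rfl (by simp),
    ShortComplex.moduleCat_exact_iff] at h0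
  obtain ⟨g, hg⟩ := h0 f hf
  exact ⟨_, g, hg⟩

/-- Vanishing of the derived-functor `Ext` gives vanishing of the derived-category `Ext`. -/
theorem abelianExt_subsingleton {R : Type} [CommRing R] {A Y : ModuleCat.{0} R}
    (n : ℕ) (h : Subsingleton (((Ext R (ModuleCat.{0} R) (n + 1)).obj (op A)).obj Y)) :
    Subsingleton (Abelian.Ext A Y (n + 1)) := by
  refine subsingleton_of_forall_eq 0 fun α => ?_
  let P := projectiveResolution A
  obtain ⟨f, hf, rfl⟩ := P.extMk_surjective α (n + 2) rfl
  rw [P.extMk_eq_zero_iff _ _ _ _ n rfl]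
  obtain ⟨j, g, rfl⟩ := exists_coboundary_of_subsingleton_ext _ h P f hf
  obtain rfl | hj := eq_or_ne j n
  · exact ⟨g, rfl⟩
  · refine ⟨0, ?_⟩
    rw [P.complex.shape (n + 1) j (fun h => hj (Nat.succ_injective h))]
    simp

theorem hom_eq_zero_of_subsingleton_ext_zero {R : Type} [CommRing R] {A Y : ModuleCat.{0} R}
    (h : Subsingleton (((Ext R (ModuleCat.{0} R) 0).obj (op A)).obj Y)) (f : A ⟶ Y) : f = 0 := by
  let P := projectiveResolution A
  obtain ⟨j, g, hg⟩ := exists_coboundary_of_subsingleton_ext _ h P (P.π.f 0 ≫ f)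
    ((Category.assoc _ _ _).symm.trans ((congrArg (fun q : P.complex.X 1 ⟶ A => q ≫ f)
      P.complex_d_comp_π_f_zero).trans Limits.zero_comp))
  rw [P.complex.shape _ _ (by simp), Limits.zero_comp] at hg
  exact (cancel_epi (P.π.f 0)).1 (hg.symm.trans Limits.comp_zero.symm)

/-- The vanishing of `Ext^{p+1}_R(M, N)` for a finitely generated module over a Noetherian ring,
expressed by iterated syzygies. -/
def ExtVanish (R N : Type) [CommRing R] [AddCommGroup N] [Module R N] :
    ℕ → ∀ (M : Type) [AddCommGroup M] [Module R M], Prop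
  | 0, M, _, _ => ∀ (k : ℕ) (f : (Fin k → R) →ₗ[R] M), Function.Surjective f →
      ∀ g : LinearMap.ker f →ₗ[R] N, ∃ h : (Fin k → R) →ₗ[R] N, ∀ x : LinearMap.ker f, h x = g x
  | p + 1, M, _, _ => ∀ (k : ℕ) (f : (Fin k → R) →ₗ[R] M), Function.Surjective f →
      ExtVanish R N p (LinearMap.ker f)

theorem extVanish_of_abelianExt {R : Type} [CommRing R] {N : Type} [AddCommGroup N] [Module R N]
    (p : ℕ) : ∀ (M : Type) [AddCommGroup M] [Module R M],
    Subsingleton (Abelian.Ext (ModuleCat.of R M) (ModuleCat.of R N) (p + 1)) →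
    ExtVanish R N p M := by
  have key : ∀ (M : Type) [AddCommGroup M] [Module R M] (k : ℕ) (f : (Fin k → R) →ₗ[R] M),
      Function.Surjective f → ∃ S : ShortComplex (ModuleCat.{0} R), S.ShortExact ∧
        S = ShortComplex.mk (ModuleCat.ofHom (LinearMap.ker f).subtype) (ModuleCat.ofHom f)
          (by ext x; exact x.2) := by
    intro M _ _ k f hf
    refine ⟨_, ?_, rfl⟩
    refine { exact := ?_, mono_f := ?_, epi_g := ?_ }
    · rw [ShortComplex.moduleCat_exact_iff]
      intro x hx
      exact ⟨⟨x, hx⟩, rfl⟩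
    · exact (ModuleCat.mono_iff_injective _).2 Subtype.val_injective
    · exact (ModuleCat.epi_iff_surjective _).2 hf
  have proj : ∀ k : ℕ, Projective (ModuleCat.of R (Fin k → R)) := fun k =>
    ModuleCat.projective_of_free (Pi.basisFun R (Fin k))
  induction p with
  | zero =>
    intro M _ _ h k f hf g
    obtain ⟨S, hS, rfl⟩ := key M k f hf
    obtain ⟨x₂, hx⟩ := Abelian.Ext.contravariant_sequence_exact₁ hS _
      (Abelian.Ext.mk₀ (ModuleCat.ofHom g)) (n₁ := 1) rfl (Subsingleton.elim _ _)
    obtain ⟨b, rfl⟩ := (Abelian.Ext.homEquiv₀ (X := _) (Y := _)).symm.surjective x₂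
    refine ⟨b.hom, fun x => ?_⟩
    have h2 : ModuleCat.ofHom (LinearMap.ker f).subtype ≫ b = ModuleCat.ofHom g := by
      apply Abelian.Ext.homEquiv₀.symm.injective
      simpa using hx
    have := congrArg (fun q => q.hom x) h2
    simpa using this
  | succ p ih =>
    intro M _ _ h k f hf
    apply ih
    obtain ⟨S, hS, rfl⟩ := key M k f hf
    refine subsingleton_of_forall_eq 0 fun α => ?_
    obtain ⟨x₂, hx⟩ := Abelian.Ext.contravariant_sequence_exact₁ hS _ α (n₁ := p + 2) (by omega)
      (Subsingleton.elim _ _)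
    have := proj k
    have h0 : x₂ = 0 := Abelian.Ext.eq_zero_of_projective _
    rw [← hx, h0]; simp

end ExtVanish

/-- Vanishing of `Ext(M, R)` passes to `Ext(M, B)` for a localization `B` of the Noetherian
ring `R`. -/
theorem ExtVanish.localization {R : Type} [CommRing R] [IsNoetherianRing R] (W : Submonoid R)
    (hW : W ≤ nonZeroDivisors R) (B : Type) [CommRing B] [Algebra R B] [IsLocalization W B]
    (p : ℕ) : ∀ (M : Type) [AddCommGroup M] [Module R M],
      ExtVanish R R p M → ExtVanish R B p M := by
  induction p with
  | succ p ih => exact fun M _ _ h k f hf => ih _ (h k f hf)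
  | zero =>
    intro M _ _ h k f hf g
    obtain ⟨t, ht⟩ := Module.Finite.fg_top (R := R) (M := LinearMap.ker f)
    classical
    obtain ⟨b, hb⟩ := IsLocalization.exist_integer_multiples_of_finset W (t.image g)
    have hinj : Function.Injective (Algebra.linearMap R B) := IsLocalization.injective B hW
    have hmem : ∀ x, (b : R) • g x ∈ LinearMap.range (Algebra.linearMap R B) := by
      intro x
      have hx : x ∈ Submodule.span R (t : Set (LinearMap.ker f)) := ht ▸ Submodule.mem_top
      induction hx using Submodule.span_induction with
      | mem x hx => exact hb _ (Finset.mem_image_of_mem g hx)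
      | zero => simp
      | add x y _ _ hx hy => rw [map_add, smul_add]; exact add_mem hx hy
      | smul a x _ hx => rw [map_smul, smul_comm]; exact Submodule.smul_mem _ _ hx
    let e := LinearEquiv.ofInjective _ hinj
    obtain ⟨h', hh'⟩ := h k f hf (e.symm.toLinearMap ∘ₗ
      LinearMap.codRestrict _ ((b : R) • g) (fun x => hmem x))
    refine ⟨LinearMap.mulLeft R (IsLocalization.mk' B 1 b) ∘ₗ Algebra.linearMap R B ∘ₗ h',
      fun x => ?_⟩
    have h1 : Algebra.linearMap R B (h' x) = (b : R) • g x := by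
      rw [hh' x]
      exact congrArg Subtype.val (e.apply_symm_apply ⟨(b : R) • g x, hmem x⟩)
    simp only [LinearMap.comp_apply, LinearMap.mulLeft_apply, h1]
    rw [Algebra.smul_def, ← mul_assoc, IsLocalization.mk'_spec, map_one, one_mul]

section Descent

open LinearMap TensorProduct

variable {R : Type} [CommRing R] {E : Type} [AddCommGroup E] [Module R E]

theorem rTensor_lTensor_comm {M N : Type} [AddCommGroup M] [Module R M] [AddCommGroup N]
    [Module R N] (f : M →ₗ[R] N) (D : E →ₗ[R] E) (z : M ⊗[R] E) :
    rTensor E f (lTensor M D z) = lTensor N D (rTensor E f z) := by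
  rw [← LinearMap.comp_apply, ← LinearMap.comp_apply, rTensor_comp_lTensor, lTensor_comp_rTensor]

theorem exists_linearMap_eq_smul {A N : Type} [AddCommGroup A] [Module R A] [AddCommGroup N]
    [Module R N] (y : R) (hy : Function.Injective fun t : N => y • t) (g : A →ₗ[R] N)
    (h : ∀ x, ∃ t, g x = y • t) : ∃ c : A →ₗ[R] N, g = y • c := by
  have hinj : Function.Injective (lsmul R N y) := hy
  refine ⟨(LinearEquiv.ofInjective _ hinj).symm.toLinearMap ∘ₗ
    codRestrict _ g (fun x => (h x).imp fun t ht => ht.symm), ?_⟩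
  ext x
  exact (congrArg Subtype.val
    ((LinearEquiv.ofInjective _ hinj).apply_symm_apply ⟨g x, (h x).imp fun t ht => ht.symm⟩)).symm

theorem smul_tensor_injective [Module.Flat R E] {N : Type} [AddCommGroup N] [Module R N] (y : R)
    (hy : Function.Injective fun t : N => y • t) :
    Function.Injective fun t : N ⊗[R] E => y • t := by
  have h := Module.Flat.rTensor_preserves_injective_linearMap (M := E) (lsmul R N y) hy
  have e : ∀ t : N ⊗[R] E, rTensor E (lsmul R N y) t = y • t := by
    intro t
    rw [show lsmul R N y = y • LinearMap.id from rfl, rTensor_smul]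
    simp
  intro a b hab
  apply h
  rw [e, e]
  exact hab

/-- One step of descent: a `D`-cycle with coefficients in `M` over `N'` gives a cycle with
coefficients in a syzygy of `M` over `N`. -/
theorem exists_syzygy_cycle [Module.Flat R E] (D : E →ₗ[R] E) (hD : D ∘ₗ D = 0)
    {N N' : Type} [AddCommGroup N] [Module R N] [AddCommGroup N'] [Module R N']
    (y : R) (hy : Function.Injective fun t : N => y • t) (q : N →ₗ[R] N')
    (hq : Function.Surjective q) (hker : ∀ x, q x = 0 → ∃ t, x = y • t)
    (u u₁ : N ⊗[R] E) (u' : N' ⊗[R] E) (hu : rTensor E q u₁ = u') (hd : lTensor N D u₁ = y • u)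
    {M : Type} [AddCommGroup M] [Module R M] (z : M ⊗[R] E) (hz : lTensor M D z = 0)
    (π : M →ₗ[R] N') (v : N' ⊗[R] E) (hv : rTensor E π z = u' + lTensor N' D v)
    (k : ℕ) (f : (Fin k → R) →ₗ[R] M) (hf : Function.Surjective f) :
    ∃ (z₁ : ker f ⊗[R] E) (π₁ : ker f →ₗ[R] N) (w : (Fin k → R) ⊗[R] E) (t : N ⊗[R] E),
      lTensor _ D z₁ = 0 ∧ rTensor E (ker f).subtype z₁ = lTensor _ D w ∧
      rTensor E π₁ z₁ = u + lTensor N D t := by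
  have hDD : ∀ {P : Type} [AddCommGroup P] [Module R P] (x : P ⊗[R] E),
      lTensor P D (lTensor P D x) = 0 := by
    intro P _ _ x
    rw [← LinearMap.comp_apply, ← lTensor_comp, hD, lTensor_zero, LinearMap.zero_apply]
  obtain ⟨w, rfl⟩ := rTensor_surjective E hf z
  have hex : Function.Exact (ker f).subtype f := fun x => by simp
  obtain ⟨z₁, hz₁⟩ := (rTensor_exact E hex hf (lTensor _ D w)).1
    (by rw [rTensor_lTensor_comm, hz])
  have hinj := Module.Flat.rTensor_preserves_injective_linearMap (M := E) (ker f).subtype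
    Subtype.val_injective
  obtain ⟨a, ha⟩ := Module.projective_lifting_property q (π ∘ₗ f) hq
  have ha' : ∀ x, q (a x) = π (f x) := fun x => LinearMap.congr_fun ha x
  obtain ⟨π₁, hπ₁⟩ := exists_linearMap_eq_smul y hy (a ∘ₗ (ker f).subtype) fun x =>
    hker _ (by simp [ha'])
  obtain ⟨v₁, rfl⟩ := rTensor_surjective E hq v
  have hexq : Function.Exact (ker q).subtype q := fun x => by simp
  obtain ⟨r, hr⟩ := (rTensor_exact E hexq hq (rTensor E a w - u₁ - lTensor N D v₁)).1 (by
    rw [map_sub, map_sub, hu, rTensor_lTensor_comm, ← LinearMap.comp_apply, ← rTensor_comp, ha,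
      rTensor_comp, LinearMap.comp_apply, hv]
    abel)
  obtain ⟨c, hc⟩ := exists_linearMap_eq_smul y hy (ker q).subtype fun x => hker _ x.2
  refine ⟨z₁, π₁, w, rTensor E c r, hinj ?_, hz₁, smul_tensor_injective (E := E) y hy ?_⟩
  · rw [rTensor_lTensor_comm, hz₁, hDD, map_zero]
  · have h1 : rTensor E a w = u₁ + lTensor N D v₁ + y • rTensor E c r := by
      rw [hc, rTensor_smul, LinearMap.smul_apply] at hr
      rw [hr]; abel
    change y • rTensor E π₁ z₁ = y • (u + lTensor N D (rTensor E c r))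
    rw [← LinearMap.smul_apply, ← rTensor_smul, ← hπ₁, rTensor_comp, LinearMap.comp_apply, hz₁,
      rTensor_lTensor_comm, h1, map_add, map_add, hDD, hd, map_smul, smul_add, add_zero]

/-- Iterated descent along a chain of quotients `N 0 → N 1 → ⋯ → N (p + 1)`. -/
theorem mem_range_of_extVanish [IsNoetherianRing R] [Module.Flat R E] (D : E →ₗ[R] E)
    (hD : D ∘ₗ D = 0) (N : ℕ → Type) [∀ k, AddCommGroup (N k)] [∀ k, Module R (N k)] (y : ℕ → R)
    (q : ∀ k, N k →ₗ[R] N (k + 1)) (u u₁ : ∀ k, N k ⊗[R] E)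
    (p : ℕ) (hy : ∀ k ≤ p, Function.Injective fun t : N k => y k • t)
    (hq : ∀ k ≤ p, Function.Surjective (q k)) (hker : ∀ k ≤ p, ∀ x, q k x = 0 → ∃ t, x = y k • t)
    (hu : ∀ k ≤ p, rTensor E (q k) (u₁ k) = u (k + 1))
    (hd : ∀ k ≤ p, lTensor (N k) D (u₁ k) = y k • u k) :
    ∀ (M : Type) [AddCommGroup M] [Module R M] [Module.Finite R M] (z : M ⊗[R] E)
      (π : M →ₗ[R] N (p + 1)) (v : N (p + 1) ⊗[R] E), ExtVanish R (N 0) p M →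
      lTensor M D z = 0 → rTensor E π z = u (p + 1) + lTensor _ D v →
      ∃ t, lTensor (N 0) D t = u 0 := by
  induction p with
  | zero =>
    intro M _ _ _ z π v hM hz hv
    obtain ⟨k, f, hf⟩ := Module.Finite.exists_fin' R M
    obtain ⟨z₁, π₁, w, t, hz₁, hw, ht⟩ := exists_syzygy_cycle D hD (y 0) (hy 0 le_rfl) (q 0)
      (hq 0 le_rfl) (hker 0 le_rfl) (u 0) (u₁ 0) (u 1) (hu 0 le_rfl) (hd 0 le_rfl) z hz π v hv
      k f hf
    obtain ⟨h, hh⟩ := hM k f hf π₁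
    have hπ : π₁ = h ∘ₗ (ker f).subtype := by ext x; exact (hh x).symm
    refine ⟨rTensor E h w - t, ?_⟩
    rw [hπ, rTensor_comp, LinearMap.comp_apply, hw, rTensor_lTensor_comm] at ht
    rw [map_sub, ht]; abel
  | succ p ih =>
    intro M _ _ _ z π v hM hz hv
    obtain ⟨k, f, hf⟩ := Module.Finite.exists_fin' R M
    obtain ⟨z₁, π₁, w, t, hz₁, hw, ht⟩ := exists_syzygy_cycle D hD (y (p + 1)) (hy _ le_rfl)
      (q (p + 1)) (hq _ le_rfl) (hker _ le_rfl) (u (p + 1)) (u₁ (p + 1)) (u (p + 2))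
      (hu _ le_rfl) (hd _ le_rfl) z hz π v hv
      k f hf
    exact ih (fun k hk => hy k (by omega)) (fun k hk => hq k (by omega))
      (fun k hk => hker k (by omega)) (fun k hk => hu k (by omega)) (fun k hk => hd k (by omega))
      _ z₁ π₁ t (hM k f hf) hz₁ ht

end Descent

section Contraction

variable {S V : Type} [CommRing S] [AddCommGroup V] [Module S V]

/-- Left contraction of the exterior algebra by a functional. -/
noncomputable def contract : Module.Dual S V →ₗ[S] Module.End S (ExteriorAlgebra S V) :=
  CliffordAlgebra.contractLeft

theorem contract_algebraMap (φ : Module.Dual S V) (r : S) :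
    contract φ (algebraMap S (ExteriorAlgebra S V) r) = 0 :=
  CliffordAlgebra.contractLeft_algebraMap _ φ r

theorem contract_one (φ : Module.Dual S V) : contract φ (1 : ExteriorAlgebra S V) = 0 := by
  simpa using contract_algebraMap φ 1

theorem contract_ι_mul (φ : Module.Dual S V) (v : V) (w : ExteriorAlgebra S V) :
    contract φ (ExteriorAlgebra.ι S v * w) = φ v • w - ExteriorAlgebra.ι S v * contract φ w :=
  CliffordAlgebra.contractLeft_ι_mul φ v w

theorem contract_mul_self (φ : Module.Dual S V) :
    (contract φ : Module.End S (ExteriorAlgebra S V)) * contract φ = 0 :=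
  LinearMap.ext fun x => CliffordAlgebra.contractLeft_contractLeft φ x

theorem contract_comm (φ ψ : Module.Dual S V) (x : ExteriorAlgebra S V) :
    contract φ (contract ψ x) = -contract ψ (contract φ x) :=
  CliffordAlgebra.contractLeft_comm φ ψ x

/-- The graded Leibniz rule. -/
theorem contract_mul (φ : Module.Dual S V) (a b : ExteriorAlgebra S V) :
    contract φ (a * b) = contract φ a * b + CliffordAlgebra.involute a * contract φ b := by
  induction a using CliffordAlgebra.left_induction with
  | algebraMap r =>
    rw [contract_algebraMap, AlgHom.commutes, ← Algebra.smul_def, ← Algebra.smul_def, map_smul,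
      zero_mul, zero_add]
  | add x y hx hy => simp only [add_mul, map_add, hx, hy]; abel
  | ι_mul x v hx =>
    rw [mul_assoc, contract_ι_mul, hx, contract_ι_mul, map_mul, CliffordAlgebra.involute_ι]
    simp only [mul_add, sub_mul, smul_mul_assoc, neg_mul, mul_assoc]
    abel

theorem contract_prod_ι_eq_zero (φ : Module.Dual S V) (l : List V) (h : ∀ v ∈ l, φ v = 0) :
    contract φ (l.map (ExteriorAlgebra.ι S)).prod = 0 := by
  induction l with
  | nil => simp [contract_one]
  | cons v l ih =>
    rw [List.map_cons, List.prod_cons, contract_ι_mul, h v (by simp),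
      ih fun w hw => h w (by simp [hw])]
    simp

theorem contract_ιMulti_eq_zero (φ : Module.Dual S V) {n : ℕ} (v : Fin n → V)
    (h : ∀ i, φ (v i) = 0) : contract φ (ExteriorAlgebra.ιMulti S n v) = 0 := by
  rw [ExteriorAlgebra.ιMulti_apply,
    show (List.ofFn fun i => ExteriorAlgebra.ι S (v i)) = (List.ofFn v).map (ExteriorAlgebra.ι S) by
      rw [List.map_ofFn]; rfl]
  refine contract_prod_ι_eq_zero φ _ fun w hw => ?_
  obtain ⟨i, rfl⟩ := (List.mem_ofFn' _ _).1 hw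
  exact h i

/-- The degree zero part of a contraction lies in the ideal generated by the values of the
functional. -/
theorem algebraMapInv_contract_mem (φ : Module.Dual S V) (J : Ideal S) (h : ∀ v, φ v ∈ J)
    (w : ExteriorAlgebra S V) : ExteriorAlgebra.algebraMapInv (contract φ w) ∈ J := by
  induction w using CliffordAlgebra.left_induction with
  | algebraMap r => rw [contract_algebraMap, map_zero]; exact J.zero_mem
  | add x y hx hy => rw [map_add, map_add]; exact J.add_mem hx hy
  | ι_mul x v hx =>
    have h0 : ExteriorAlgebra.algebraMapInv (ExteriorAlgebra.ι S v) = 0 := by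
      simp [ExteriorAlgebra.algebraMapInv]
    rw [contract_ι_mul, map_sub, map_smul, map_mul, h0, zero_mul, sub_zero, smul_eq_mul]
    exact J.mul_mem_right _ (h v)

/-- Iterated contraction, as an algebra homomorphism on the exterior algebra of the dual. -/
noncomputable def multiContract :
    ExteriorAlgebra S (Module.Dual S V) →ₐ[S] Module.End S (ExteriorAlgebra S V) :=
  ExteriorAlgebra.lift S ⟨contract, contract_mul_self⟩

theorem multiContract_ι (φ : Module.Dual S V) :
    multiContract (ExteriorAlgebra.ι S φ) = contract φ :=
  ExteriorAlgebra.lift_ι_apply S _ _ _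

theorem multiContract_ιMulti {n : ℕ} (φ : Fin n → Module.Dual S V) :
    multiContract (ExteriorAlgebra.ιMulti S n φ) = (List.ofFn fun i => contract (φ i)).prod := by
  rw [ExteriorAlgebra.ιMulti_apply, map_list_prod, List.map_ofFn]
  congr 2
  funext i
  exact multiContract_ι _

theorem ιMulti_succ_last {n : ℕ} {M : Type} [AddCommGroup M] [Module S M] (v : Fin (n + 1) → M) :
    ExteriorAlgebra.ιMulti S (n + 1) v =
      ExteriorAlgebra.ιMulti S n (v ∘ Fin.castSucc) * ExteriorAlgebra.ι S (v (Fin.last n)) := by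
  rw [ExteriorAlgebra.ιMulti_apply, ExteriorAlgebra.ιMulti_apply, List.ofFn_succ']
  simp

theorem contract_multiContract_ιMulti {n : ℕ} (φ : Fin n → Module.Dual S V) (j : Fin n)
    (x : ExteriorAlgebra S V) :
    contract (φ j) (multiContract (ExteriorAlgebra.ιMulti S n φ) x) = 0 := by
  rw [← multiContract_ι, ← Module.End.mul_apply, ← map_mul]
  have := ExteriorAlgebra.ιMulti_succ_apply (R := S) (Matrix.vecCons (φ j) φ)
  rw [AlternatingMap.map_eq_zero_of_eq _ _ (i := 0) (j := j.succ) (by simp)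
    (Fin.succ_ne_zero j).symm] at this
  simp only [Matrix.cons_val_zero, Matrix.tail_cons] at this
  rw [← this]; simp

theorem contract_multiContract_comm (ψ : Module.Dual S V) {n : ℕ} (φ : Fin n → Module.Dual S V) :
    ∃ c : S, ∀ x, contract ψ (multiContract (ExteriorAlgebra.ιMulti S n φ) x) =
      c • multiContract (ExteriorAlgebra.ιMulti S n φ) (contract ψ x) := by
  have key : ∀ l : List (Module.Dual S V), ∃ c : S, ∀ x : ExteriorAlgebra S V,
      contract ψ ((l.map contract).prod x) = c • (l.map contract).prod (contract ψ x) := by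
    intro l
    induction l with
    | nil => exact ⟨1, fun x => by simp⟩
    | cons φ l ih =>
      obtain ⟨c, hc⟩ := ih
      refine ⟨-c, fun x => ?_⟩
      rw [List.map_cons, List.prod_cons, Module.End.mul_apply, Module.End.mul_apply,
        contract_comm, hc, map_smul, neg_smul]
  rw [multiContract_ιMulti]
  simpa [List.map_ofFn, Function.comp_def] using key (List.ofFn φ)

theorem contract_ιMulti (φ : Module.Dual S V) {n : ℕ} (v : Fin (n + 1) → V) :
    contract φ (ExteriorAlgebra.ιMulti S (n + 1) v) =
      ∑ j : Fin (n + 1), ((-1) ^ (j : ℕ) * φ (v j)) •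
        ExteriorAlgebra.ιMulti S n (v ∘ j.succAbove) := by
  induction n with
  | zero =>
    rw [ExteriorAlgebra.ιMulti_succ_apply, contract_ι_mul, ExteriorAlgebra.ιMulti_zero_apply,
      contract_one]
    simp
  | succ n ih =>
    rw [ExteriorAlgebra.ιMulti_succ_apply, contract_ι_mul, ih, Finset.mul_sum, sub_eq_add_neg,
      ← Finset.sum_neg_distrib]
    conv_rhs => rw [Fin.sum_univ_succ]
    congr 1
    · simp [Matrix.vecTail, Function.comp_def]
    · refine Finset.sum_congr rfl fun j _ => ?_
      rw [ExteriorAlgebra.ιMulti_succ_apply (v ∘ j.succ.succAbove)]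
      simp only [mul_smul_comm, ← neg_smul, Function.comp_apply, Fin.succ_succAbove_zero,
        Matrix.vecTail, Fin.val_succ, pow_succ]
      congr 1
      · ring
      · congr 2
        funext i
        simp

/-- The pairing between iterated contractions and products of vectors is a determinant up to
a universal sign. -/
theorem exists_multiContract_ιMulti_eq_det (S : Type) [CommRing S] (n : ℕ) :
    ∃ c : S, IsUnit c ∧ ∀ (V : Type) [AddCommGroup V] [Module S V]
      (φ : Fin n → Module.Dual S V) (v : Fin n → V),
      multiContract (ExteriorAlgebra.ιMulti S n φ) (ExteriorAlgebra.ιMulti S n v) =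
        algebraMap S _ (c * (Matrix.of fun i j => φ i (v j)).det) := by
  induction n with
  | zero => exact ⟨1, isUnit_one, fun V _ _ φ v => by simp⟩
  | succ n ih =>
    obtain ⟨c, hc, h⟩ := ih
    refine ⟨c * (-1) ^ n, hc.mul (isUnit_one.neg.pow n), fun V _ _ φ v => ?_⟩
    rw [ιMulti_succ_last, map_mul, multiContract_ι, Module.End.mul_apply, contract_ιMulti, map_sum,
      Matrix.det_succ_row _ (Fin.last n), Finset.mul_sum, map_sum]
    refine Finset.sum_congr rfl fun j _ => ?_
    rw [map_smul, h, Algebra.smul_def, ← map_mul]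
    congr 1
    have : (Matrix.of fun i j => φ i (v j)).submatrix (Fin.last n).succAbove j.succAbove =
        Matrix.of fun i k => (φ ∘ Fin.castSucc) i ((v ∘ j.succAbove) k) := by
      ext; simp
    rw [this, Fin.val_last, pow_add, Matrix.of_apply]
    have h1 : ((-1 : S) ^ n) * (-1) ^ n = 1 := by rw [← mul_pow]; simp
    linear_combination ((-(-1) ^ (j : ℕ) * φ (Fin.last n) (v j) * c *
      (Matrix.of fun i k => (φ ∘ Fin.castSucc) i ((v ∘ j.succAbove) k)).det)) * h1

end Contraction

section Cycle

variable {S V : Type} [CommRing S] [AddCommGroup V] [Module S V]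

theorem map_mem_smul_top {M N : Type} [AddCommGroup M] [Module S M] [AddCommGroup N] [Module S N]
    (f : M →ₗ[S] N) (J : Ideal S) {x : M} (hx : x ∈ (J • ⊤ : Submodule S M)) :
    f x ∈ (J • ⊤ : Submodule S N) := by
  have h : f x ∈ (J • ⊤ : Submodule S M).map f := ⟨x, hx, rfl⟩
  rw [Submodule.map_smul''] at h
  exact Submodule.smul_mono le_rfl le_top h

theorem mul_mem_smul_top_left {A : Type} [Ring A] [Algebra S A] (J : Ideal S) (a : A) {x : A}
    (hx : x ∈ (J • ⊤ : Submodule S A)) : a * x ∈ (J • ⊤ : Submodule S A) :=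
  map_mem_smul_top (LinearMap.mulLeft S a) J hx

/-- The operators that commute, modulo an ideal, with right multiplication by `U`. -/
def rightLinearMod (J : Ideal S) (U : ExteriorAlgebra S V) :
    Submonoid (Module.End S (ExteriorAlgebra S V)) where
  carrier := {T | ∀ w, T (w * U) - T w * U ∈ (J • ⊤ : Submodule S (ExteriorAlgebra S V))}
  one_mem' w := by simp
  mul_mem' {T T'} hT hT' w := by
    have h1 := map_mem_smul_top T J (hT' w)
    have h2 := hT (T' w)
    rw [map_sub] at h1
    simpa using add_mem h1 h2

theorem multiContract_mul_sub_mem {n : ℕ} (J : Ideal S) (U : ExteriorAlgebra S V)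
    (φ : Fin n → Module.Dual S V)
    (hU : ∀ j, contract (φ j) U ∈ (J • ⊤ : Submodule S (ExteriorAlgebra S V)))
    (w : ExteriorAlgebra S V) :
    multiContract (ExteriorAlgebra.ιMulti S n φ) (w * U) -
      multiContract (ExteriorAlgebra.ιMulti S n φ) w * U ∈
        (J • ⊤ : Submodule S (ExteriorAlgebra S V)) := by
  have : multiContract (ExteriorAlgebra.ιMulti S n φ) ∈ rightLinearMod J U := by
    rw [multiContract_ιMulti]
    refine Submonoid.list_prod_mem _ fun T hT => ?_
    obtain ⟨j, rfl⟩ := (List.mem_ofFn' _ _).1 hT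
    intro w
    rw [contract_mul, add_sub_cancel_left]
    exact mul_mem_smul_top_left J _ (hU j)
  exact this w

/-- The composite of the contraction operators of the blocks `0, …, k - 1`. -/
noncomputable def blockContract {n : ℕ} (φ : ℕ → Fin n → Module.Dual S V) :
    ℕ → Module.End S (ExteriorAlgebra S V)
  | 0 => 1
  | k + 1 => blockContract φ k * multiContract (ExteriorAlgebra.ιMulti S n (φ k))

/-- The product of `U` with the top vectors of the blocks `0, …, k - 1`. -/
noncomputable def blockProduct {n : ℕ} (e : ℕ → Fin n → V) (U : ExteriorAlgebra S V) :
    ℕ → ExteriorAlgebra S V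
  | 0 => U
  | k + 1 => ExteriorAlgebra.ιMulti S n (e k) * blockProduct e U k

theorem contract_blockContract {n : ℕ} (φ : ℕ → Fin n → Module.Dual S V) (k : ℕ) :
    ∀ b < k, ∀ j x, contract (φ b j) (blockContract φ k x) = 0 := by
  induction k with
  | zero => simp
  | succ k ih =>
    intro b hb j x
    rw [blockContract, Module.End.mul_apply]
    obtain hb | rfl := Nat.lt_succ_iff_lt_or_eq.1 hb
    · exact ih b hb j _
    · have key : ∀ l ≤ b, ∃ c : S, ∀ x, contract (φ b j) (blockContract φ l x) =
          c • blockContract φ l (contract (φ b j) x) := by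
        intro l
        induction l with
        | zero => exact fun _ => ⟨1, fun x => by simp [blockContract]⟩
        | succ l ihl =>
          intro hl
          obtain ⟨c, hc⟩ := ihl (by omega)
          obtain ⟨c', hc'⟩ := contract_multiContract_comm (φ b j) (φ l)
          refine ⟨c * c', fun x => ?_⟩
          rw [blockContract, Module.End.mul_apply, hc, hc', map_smul, mul_smul,
            Module.End.mul_apply]
      obtain ⟨c, hc⟩ := key b le_rfl
      rw [hc, contract_multiContract_ιMulti, map_zero, smul_zero]

theorem blockContract_mem {n : ℕ} (φ : ℕ → Fin n → Module.Dual S V) (I : Ideal S)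
    (hI : ∀ k, ExteriorAlgebra.ιMulti S n (φ k) ∈
      (I • ⊤ : Submodule S (ExteriorAlgebra S (Module.Dual S V)))) (k : ℕ)
    (x : ExteriorAlgebra S V) :
    blockContract φ k x ∈ (I ^ k • ⊤ : Submodule S (ExteriorAlgebra S V)) := by
  induction k generalizing x with
  | zero => simp
  | succ k ih =>
    have h1 : multiContract (ExteriorAlgebra.ιMulti S n (φ k)) x ∈
        (I • ⊤ : Submodule S (ExteriorAlgebra S V)) :=
      map_mem_smul_top (LinearMap.applyₗ x ∘ₗ multiContract.toLinearMap) I (hI k)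
    rw [blockContract, Module.End.mul_apply, pow_succ']
    refine Submodule.smul_induction_on h1 (fun r hr y _ => ?_) fun a b ha hb => ?_
    · rw [map_smul, mul_smul]
      exact Submodule.smul_mem_smul hr (ih y)
    · rw [map_add]; exact add_mem ha hb

theorem contract_blockProduct_mem {n : ℕ} (J : Ideal S) (ψ : Module.Dual S V) (e : ℕ → Fin n → V)
    (U : ExteriorAlgebra S V)
    (hU : contract ψ U ∈ (J • ⊤ : Submodule S (ExteriorAlgebra S V))) (k : ℕ)
    (he : ∀ b < k, ∀ t, ψ (e b t) = 0) :
    contract ψ (blockProduct e U k) ∈ (J • ⊤ : Submodule S (ExteriorAlgebra S V)) := by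
  induction k with
  | zero => exact hU
  | succ k ih =>
    rw [blockProduct, contract_mul, contract_ιMulti_eq_zero _ _ (he k (by omega)), zero_mul,
      zero_add]
    exact mul_mem_smul_top_left J _ (ih fun b hb => he b (by omega))

/-- Construction of a cycle with coefficients in `I ^ s` that is, modulo `J`, a multiple of `U`
by a power of a determinant. -/
theorem exists_contract_cycle {n : ℕ} (s : ℕ) (I J : Ideal S) (φ : ℕ → Fin n → Module.Dual S V)
    (e : ℕ → Fin n → V) (A : Matrix (Fin n) (Fin n) S) (c : ℕ → Fin n) (U : ExteriorAlgebra S V)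
    (hI : ∀ k, ExteriorAlgebra.ιMulti S n (φ k) ∈
      (I • ⊤ : Submodule S (ExteriorAlgebra S (Module.Dual S V))))
    (he : ∀ k j t, φ k j (e k t) = A t j)
    (he0 : ∀ k k', k ≠ k' → ∀ j t, φ k j (e k' t) = 0)
    (hU : ∀ k j, contract (φ k j) U ∈ (J • ⊤ : Submodule S (ExteriorAlgebra S V))) :
    ∃ ω ∈ (I ^ s • ⊤ : Submodule S (ExteriorAlgebra S V)),
      contract (∑ k ∈ Finset.range s, φ k (c k)) ω = 0 ∧
      ∃ r : S, IsUnit r ∧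
        ω - (r * A.det ^ s) • U ∈ (J • ⊤ : Submodule S (ExteriorAlgebra S V)) := by
  refine ⟨blockContract φ s (blockProduct e U s), blockContract_mem φ I hI s _, ?_, ?_⟩
  · rw [map_sum, LinearMap.sum_apply]
    exact Finset.sum_eq_zero fun k hk => contract_blockContract φ s k (Finset.mem_range.1 hk) _ _
  · obtain ⟨r, hr, hdet⟩ := exists_multiContract_ιMulti_eq_det S n
    refine ⟨r ^ s, hr.pow s, ?_⟩
    rw [← mul_pow]
    induction s with
    | zero => simp [blockContract, blockProduct]
    | succ k ih =>
      have h1 := multiContract_mul_sub_mem J (blockProduct e U k) (φ k)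
        (fun j => contract_blockProduct_mem J _ e U (hU k j) k fun b hb t =>
          he0 k b (by omega) j t) (ExteriorAlgebra.ιMulti S n (e k))
      have hA : (Matrix.of fun i j => φ k i (e k j)) = A.transpose := by
        ext i j; exact he k i j
      rw [hdet, hA, Matrix.det_transpose, ← Algebra.smul_def] at h1
      have h2 := map_mem_smul_top (blockContract φ k) J h1
      have h3 := Submodule.smul_mem _ (r * A.det) ih
      rw [map_sub, map_smul] at h2
      rw [smul_sub, smul_smul, ← pow_succ'] at h3
      have h4 := add_mem h2 h3
      rwa [sub_add_sub_cancel] at h4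

/-- In characteristic zero, the value of an alternating map at linear combinations given by a
matrix has coefficients in the ideal of maximal minors. -/
theorem alternatingMap_sum_mem {m n : ℕ} {M N : Type} [AddCommGroup M] [Module S M]
    [AddCommGroup N] [Module S N] (F : M [⋀^Fin n]→ₗ[S] N) (X : Matrix (Fin m) (Fin n) S)
    (I : Ideal S) (hI : ∀ g : Fin n → Fin m, (X.submatrix g id).det ∈ I)
    (hn : IsUnit (n.factorial : S)) (ε : Fin m → M) :
    F (fun j => ∑ i, X i j • ε i) ∈ (I • ⊤ : Submodule S N) := by
  have h1 : F (fun j => ∑ i, X i j • ε i) =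
      ∑ g : Fin n → Fin m, (∏ j, X (g j) j) • F (fun j => ε (g j)) := by
    rw [← AlternatingMap.coe_multilinearMap, MultilinearMap.map_sum]
    exact Finset.sum_congr rfl fun g _ => MultilinearMap.map_smul_univ _ _ _
  have h2 : (n.factorial : S) • F (fun j => ∑ i, X i j • ε i) =
      ∑ g : Fin n → Fin m, (X.submatrix g id).det • F (fun j => ε (g j)) := by
    have h3 : ∀ σ : Equiv.Perm (Fin n), F (fun j => ∑ i, X i j • ε i) =
        ∑ g : Fin n → Fin m,
          ((Equiv.Perm.sign σ : ℤ) • ∏ j, X (g (σ j)) j) • F (fun j => ε (g j)) := by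
      intro σ
      rw [h1, ← (Equiv.arrowCongr σ (Equiv.refl (Fin m))).symm.sum_comp]
      refine Finset.sum_congr rfl fun g _ => ?_
      have h4 := F.map_perm (fun j => ε (g j)) σ
      have h5 : (fun j => ε (((Equiv.arrowCongr σ (Equiv.refl (Fin m))).symm g) j)) =
          (fun j => ε (g j)) ∘ σ := by
        funext j; simp [Equiv.arrowCongr]
      rw [h5, h4]
      simp only [Equiv.arrowCongr, Equiv.coe_fn_symm_mk, Equiv.refl_symm, Equiv.coe_refl,
        Function.comp_apply, id, Units.smul_def, smul_assoc]
      exact smul_comm _ _ _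
    have h6 : ∑ σ : Equiv.Perm (Fin n), F (fun j => ∑ i, X i j • ε i) =
        (n.factorial : S) • F (fun j => ∑ i, X i j • ε i) := by
      simp [Fintype.card_perm, Nat.cast_smul_eq_nsmul]
    rw [← h6, Finset.sum_congr rfl fun σ _ => h3 σ, Finset.sum_comm]
    refine Finset.sum_congr rfl fun g _ => ?_
    rw [Matrix.det_apply, Finset.sum_smul]
    simp [Units.smul_def]
  obtain ⟨u, hu⟩ := hn
  have h7 : F (fun j => ∑ i, X i j • ε i) = (↑u⁻¹ : S) •
      ∑ g : Fin n → Fin m, (X.submatrix g id).det • F (fun j => ε (g j)) := by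
    rw [← h2, smul_smul, ← hu, Units.inv_mul, one_smul]
  rw [h7]
  exact Submodule.smul_mem _ _ (Submodule.sum_mem _ fun g _ =>
    Submodule.smul_mem_smul (hI g) Submodule.mem_top)

end Cycle

section PivotMatrix

variable {m n : ℕ} (h : n ≤ m) (s : ℕ) {T T' : Type} [CommRing T] [CommRing T']

/-- The top square block of a matrix with its first `s` columns replaced by standard basis
vectors. -/
def pivotMatrix (x : Matrix (Fin m) (Fin n) T) : Matrix (Fin n) (Fin n) T :=
  Matrix.of fun t j => if s ≤ (j : ℕ) then x (Fin.castLE h t) j else if t = j then 1 else 0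

/-- The minor of the top rows and columns of index at least `s`. -/
noncomputable def pivotDet (x : Matrix (Fin m) (Fin n) T) : T := (pivotMatrix h s x).det

/-- Cramer coefficients: they express the pivot determinant times row `i`, restricted to the
columns of index at least `s`, through the top rows. -/
noncomputable def pivotCoeff (x : Matrix (Fin m) (Fin n) T) (i : Fin m) (t : Fin n) : T :=
  ∑ j : Fin n, (if s ≤ (j : ℕ) then x i j else 0) * (pivotMatrix h s x).adjugate j t

/-- The error in the Cramer expression of row `i`, at column `j`. -/
noncomputable def pivotDefect (x : Matrix (Fin m) (Fin n) T) (i : Fin m) (j : Fin n) : T :=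
  pivotDet h s x * x i j - ∑ t, pivotCoeff h s x i t * x (Fin.castLE h t) j

theorem sum_pivotCoeff_mul (x : Matrix (Fin m) (Fin n) T) (i : Fin m) (j : Fin n) :
    ∑ t, pivotCoeff h s x i t * pivotMatrix h s x t j =
      pivotDet h s x * if s ≤ (j : ℕ) then x i j else 0 := by
  have h1 := Matrix.adjugate_mul (pivotMatrix h s x)
  simp only [pivotCoeff, Finset.sum_mul, mul_assoc]
  rw [Finset.sum_comm]
  simp only [← Finset.mul_sum, ← Matrix.mul_apply, h1]
  rw [Finset.sum_eq_single j (fun b _ hb => by simp [hb]) (by simp)]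
  simp [pivotDet, mul_comm]

theorem pivotCoeff_eq_zero (x : Matrix (Fin m) (Fin n) T) (i : Fin m) (j : Fin n)
    (hj : (j : ℕ) < s) : pivotCoeff h s x i j = 0 := by
  have := sum_pivotCoeff_mul h s x i j
  simpa [pivotMatrix, not_le.2 hj] using this

theorem pivotDefect_eq_zero (x : Matrix (Fin m) (Fin n) T) (i : Fin m) (j : Fin n)
    (hj : s ≤ (j : ℕ)) : pivotDefect h s x i j = 0 := by
  have := sum_pivotCoeff_mul h s x i j
  simp only [pivotMatrix, Matrix.of_apply, hj, if_true] at this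
  rw [pivotDefect, this, sub_self]

theorem pivotMatrix_map (f : T →+* T') (x : Matrix (Fin m) (Fin n) T) :
    f.mapMatrix (pivotMatrix h s x) = pivotMatrix h s (x.map f) := by
  ext t j
  simp only [pivotMatrix, RingHom.mapMatrix_apply, Matrix.map_apply, Matrix.of_apply]
  split_ifs <;> simp

theorem map_pivotDet (f : T →+* T') (x : Matrix (Fin m) (Fin n) T) :
    f (pivotDet h s x) = pivotDet h s (x.map f) := by
  rw [pivotDet, RingHom.map_det, pivotMatrix_map, pivotDet]

theorem map_pivotCoeff (f : T →+* T') (x : Matrix (Fin m) (Fin n) T) (i : Fin m) (t : Fin n) :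
    f (pivotCoeff h s x i t) = pivotCoeff h s (x.map f) i t := by
  simp only [pivotCoeff, map_sum, map_mul, ← pivotMatrix_map, ← RingHom.map_adjugate]
  refine Finset.sum_congr rfl fun j _ => ?_
  congr 1
  split_ifs <;> simp

theorem map_pivotDefect (f : T →+* T') (x : Matrix (Fin m) (Fin n) T) (i : Fin m) (j : Fin n) :
    f (pivotDefect h s x i j) = pivotDefect h s (x.map f) i j := by
  simp [pivotDefect, map_pivotDet, map_pivotCoeff]

theorem pivotMatrix_congr {x x' : Matrix (Fin m) (Fin n) T}
    (hx : ∀ (i : Fin m) (j : Fin n), s ≤ (j : ℕ) → x i j = x' i j) :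
    pivotMatrix h s x = pivotMatrix h s x' := by
  ext t j
  simp only [pivotMatrix, Matrix.of_apply]
  split_ifs with hj
  · exact hx _ _ hj
  all_goals rfl

theorem pivotDet_congr {x x' : Matrix (Fin m) (Fin n) T}
    (hx : ∀ (i : Fin m) (j : Fin n), s ≤ (j : ℕ) → x i j = x' i j) :
    pivotDet h s x = pivotDet h s x' := by
  rw [pivotDet, pivotMatrix_congr h s hx, pivotDet]

theorem pivotCoeff_congr {x x' : Matrix (Fin m) (Fin n) T}
    (hx : ∀ (i : Fin m) (j : Fin n), s ≤ (j : ℕ) → x i j = x' i j) (i : Fin m) (t : Fin n) :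
    pivotCoeff h s x i t = pivotCoeff h s x' i t := by
  simp only [pivotCoeff, pivotMatrix_congr h s hx]
  refine Finset.sum_congr rfl fun j _ => ?_
  split_ifs with hj
  · rw [hx _ _ hj]
  · rfl

theorem pivotDet_eq_one {x : Matrix (Fin m) (Fin n) T}
    (hx : ∀ (t j : Fin n), s ≤ (j : ℕ) → x (Fin.castLE h t) j = if t = j then 1 else 0) :
    pivotDet h s x = 1 := by
  have : pivotMatrix h s x = 1 := by
    ext t j
    simp only [pivotMatrix, Matrix.of_apply, Matrix.one_apply]
    split_ifs with hj <;> simp_all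
  rw [pivotDet, this, Matrix.det_one]

end PivotMatrix

section Regularity

variable (K : Type) [Field K] {m n : ℕ} (h : n ≤ m) (s : ℕ)

/-- The generic matrix. -/
noncomputable def genMatrix (m n : ℕ) : Matrix (Fin m) (Fin n) (MvPolynomial (Fin m × Fin n) K) :=
  Matrix.of fun i j => X (i, j)

theorem genMatrix_map_eval (f : Fin m × Fin n → K) :
    (genMatrix K m n).map (eval f) = Matrix.of fun i j => f (i, j) := by
  ext i j; simp [genMatrix]

theorem pivotDet_genMatrix_ne_zero : pivotDet h s (genMatrix K m n) ≠ 0 := by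
  intro h0
  have := congrArg
    (eval fun ij : Fin m × Fin n => if ij.1 = Fin.castLE h ij.2 then (1 : K) else 0) h0
  rw [map_pivotDet, genMatrix_map_eval, pivotDet_eq_one, map_zero] at this
  · exact one_ne_zero this
  · intro t j _; simp

theorem det_top_genMatrix_ne_zero :
    ((genMatrix K m n).submatrix (Fin.castLE h) id).det ≠ 0 := by
  intro h0
  have := congrArg
    (eval fun ij : Fin m × Fin n => if ij.1 = Fin.castLE h ij.2 then (1 : K) else 0) h0
  rw [RingHom.map_det, map_zero] at this
  have h1 : (eval fun ij : Fin m × Fin n =>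
      if ij.1 = Fin.castLE h ij.2 then (1 : K) else 0).mapMatrix
      ((genMatrix K m n).submatrix (Fin.castLE h) id) = 1 := by
    ext t j; simp [genMatrix, Matrix.one_apply]
  rw [h1, Matrix.det_one] at this
  exact one_ne_zero this

theorem pivotDefect_genMatrix_ne_zero (i : Fin m) (j : Fin n) (hi : n ≤ (i : ℕ))
    (hj : (j : ℕ) < s) : pivotDefect h s (genMatrix K m n) i j ≠ 0 := by
  intro h0
  have hne : ∀ t : Fin n, i ≠ Fin.castLE h t := fun t ht => by
    have := congrArg Fin.val ht
    simp at this; omega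
  have := congrArg (eval fun ij : Fin m × Fin n =>
    if ij.1 = Fin.castLE h ij.2 ∨ ij = (i, j) then (1 : K) else 0) h0
  rw [map_pivotDefect, genMatrix_map_eval, pivotDefect, pivotDet_eq_one, map_zero,
    Finset.sum_eq_single j] at this
  · rw [pivotCoeff_eq_zero h s _ _ _ hj] at this
    simp at this
  · intro t _ ht
    simp [ht, (hne t).symm]
  · simp
  · intro t j' _; simp [(hne t).symm]

/-- Endomorphisms of the localization defined by changing the variables of the first `s`
columns. -/
theorem exists_substitution (B : Type) [CommRing B] [Algebra (MvPolynomial (Fin m × Fin n) K) B]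
    [IsLocalization.Away (pivotDet h s (genMatrix K m n)) B] (x : Matrix (Fin m) (Fin n) B)
    (hx : ∀ (i : Fin m) (j : Fin n), s ≤ (j : ℕ) →
      x i j = algebraMap (MvPolynomial (Fin m × Fin n) K) B (X (i, j)))
    (J : Ideal B)
    (hJ : ∀ i j, x i j - algebraMap (MvPolynomial (Fin m × Fin n) K) B (X (i, j)) ∈ J) :
    ∃ ψ : B →+* B, (genMatrix K m n).map (ψ.comp (algebraMap _ B)) = x ∧ ∀ b, ψ b - b ∈ J := by
  let χ : MvPolynomial (Fin m × Fin n) K →+* B :=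
    eval₂Hom ((algebraMap (MvPolynomial (Fin m × Fin n) K) B).comp C) fun ij => x ij.1 ij.2
  have hχ : (genMatrix K m n).map χ = x := by ext i j; simp [χ, genMatrix]
  have hu : IsUnit (χ (pivotDet h s (genMatrix K m n))) := by
    have : χ (pivotDet h s (genMatrix K m n)) =
        algebraMap _ B (pivotDet h s (genMatrix K m n)) := by
      rw [map_pivotDet, map_pivotDet, hχ]
      exact pivotDet_congr h s fun i j hj => by simp [hx i j hj, genMatrix]
    rw [this]
    exact IsLocalization.Away.algebraMap_isUnit _
  refine ⟨IsLocalization.Away.lift (pivotDet h s (genMatrix K m n)) hu, ?_, ?_⟩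
  · rw [IsLocalization.Away.lift_comp, hχ]
  · have key : (Ideal.Quotient.mk J).comp
        (IsLocalization.Away.lift (pivotDet h s (genMatrix K m n)) hu) = Ideal.Quotient.mk J := by
      refine IsLocalization.ringHom_ext
        (Submonoid.powers (pivotDet h s (genMatrix K m n))) ?_
      rw [RingHom.comp_assoc, IsLocalization.Away.lift_comp]
      refine MvPolynomial.ringHom_ext (fun r => ?_) fun ij => ?_
      · simp [χ]
      · simpa [χ] using Ideal.Quotient.eq.2 (hJ ij.1 ij.2)
    intro b
    exact Ideal.Quotient.eq.1 (RingHom.congr_fun key b)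

/-- The ideal generated by the first `k` defects. -/
noncomputable def defectIdeal (P : ℕ → Fin m × Fin n) (k : ℕ) :
    Ideal (MvPolynomial (Fin m × Fin n) K) :=
  Ideal.span {f | ∃ l < k, f = pivotDefect h s (genMatrix K m n) (P l).1 (P l).2}

variable (P : ℕ → Fin m × Fin n)

theorem exists_retraction (B : Type) [CommRing B] [Algebra (MvPolynomial (Fin m × Fin n) K) B]
    [IsLocalization.Away (pivotDet h s (genMatrix K m n)) B] (k : ℕ)
    (hP : ∀ l < k, n ≤ ((P l).1 : ℕ) ∧ ((P l).2 : ℕ) < s) :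
    ∃ ψ : B →+* B,
      (∀ i j, (∀ l < k, P l ≠ (i, j)) →
        ψ (algebraMap (MvPolynomial (Fin m × Fin n) K) B (X (i, j))) =
        algebraMap (MvPolynomial (Fin m × Fin n) K) B (X (i, j))) ∧
      (∀ b, ψ b - b ∈ (defectIdeal K h s P k).map (algebraMap _ B)) ∧
      (defectIdeal K h s P k).map (algebraMap _ B) ≤ RingHom.ker ψ := by
  classical
  have hne : ∀ l < k, ∀ (i : Fin m) (j : Fin n), ((i : ℕ) < n ∨ s ≤ (j : ℕ)) → P l ≠ (i, j) := by
    intro l hl i j hij h0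
    have := hP l hl
    rw [h0] at this
    simp at this; omega
  obtain ⟨v, hv⟩ := IsLocalization.Away.algebraMap_isUnit (S := B)
    (pivotDet h s (genMatrix K m n))
  let ρ := algebraMap (MvPolynomial (Fin m × Fin n) K) B
  have hvinv : (↑v⁻¹ : B) * ρ (pivotDet h s (genMatrix K m n)) = 1 := by
    rw [← hv]; exact v.inv_mul
  let x : Matrix (Fin m) (Fin n) B := Matrix.of fun i j =>
    if ∃ l < k, P l = (i, j) then
      ↑v⁻¹ * ρ (∑ t, pivotCoeff h s (genMatrix K m n) i t * X (Fin.castLE h t, j))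
    else ρ (X (i, j))
  have hx : ∀ i j, (∀ l < k, P l ≠ (i, j)) → x i j = ρ (X (i, j)) := by
    intro i j hij
    simp only [x, Matrix.of_apply]
    rw [if_neg]
    rintro ⟨l, hl, h0⟩
    exact hij l hl h0
  obtain ⟨ψ, hψ, hψJ⟩ := exists_substitution K h s B x
    (fun i j hj => hx i j fun l hl => hne l hl i j (Or.inr hj))
    ((defectIdeal K h s P k).map (algebraMap _ B)) (by
      intro i j
      by_cases hij : ∃ l < k, P l = (i, j)
      · have hd : pivotDefect h s (genMatrix K m n) i j ∈ defectIdeal K h s P k := by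
          obtain ⟨l, hl, h0⟩ := hij
          exact Ideal.subset_span ⟨l, hl, by rw [h0]⟩
        have h1 := Ideal.mul_mem_left _ (-(↑v⁻¹ : B)) (Ideal.mem_map_of_mem ρ hd)
        have h2 : x i j - ρ (X (i, j)) =
            -(↑v⁻¹ : B) * ρ (pivotDefect h s (genMatrix K m n) i j) := by
          simp only [x, Matrix.of_apply, if_pos hij, pivotDefect, map_sub, map_mul]
          simp only [genMatrix, Matrix.of_apply] at hvinv ⊢
          linear_combination (ρ (X (i, j))) * hvinv
        exact h2 ▸ h1
      · have h1 : x i j = ρ (X (i, j)) := hx i j fun l hl h0 => hij ⟨l, hl, h0⟩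
        rw [h1, sub_self]
        exact Ideal.zero_mem _)
  have hψX : ∀ i j, ψ (ρ (X (i, j))) = x i j := fun i j => by
    rw [← hψ]; simp [genMatrix, ρ]
  refine ⟨ψ, fun i j hij => (hψX i j).trans (hx i j hij), hψJ, ?_⟩
  rw [Ideal.map_le_iff_le_comap, defectIdeal, Ideal.span_le]
  rintro _ ⟨l, hl, rfl⟩
  change (ψ.comp ρ) _ = 0
  rw [map_pivotDefect, hψ]
  have hx1 : ∀ (i : Fin m) (j : Fin n), s ≤ (j : ℕ) →
      x i j = (genMatrix K m n).map ρ i j := fun i j hj =>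
    hx i j fun l hl => hne l hl i j (Or.inr hj)
  rw [pivotDefect, pivotDet_congr h s hx1, ← map_pivotDet]
  simp only [pivotCoeff_congr h s hx1, ← map_pivotCoeff]
  have hx2 : ∀ t j, x (Fin.castLE h t) j = ρ (X (Fin.castLE h t, j)) := fun t j =>
    hx _ _ fun l hl => hne l hl _ _ (Or.inl (by simp))
  simp only [hx2, ← map_mul, ← map_sum]
  have hx3 : x (P l).1 (P l).2 = ↑v⁻¹ * ρ (∑ t, pivotCoeff h s (genMatrix K m n) (P l).1 t *
      X (Fin.castLE h t, (P l).2)) := by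
    simp only [x, Matrix.of_apply]
    exact if_pos ⟨l, hl, rfl⟩
  rw [hx3]
  linear_combination (ρ (∑ t, pivotCoeff h s (genMatrix K m n) (P l).1 t *
      X (Fin.castLE h t, (P l).2))) * hvinv

/-- Polynomials fixed by the retraction are nonzerodivisors modulo the defect ideal. -/
theorem smul_injective_of_map_ne_zero (B : Type) [CommRing B] [IsDomain B]
    [Algebra (MvPolynomial (Fin m × Fin n) K) B] (J : Ideal B) (ψ : B →+* B)
    (hψ : ∀ b, ψ b - b ∈ J) (hJ : J ≤ RingHom.ker ψ) (r : MvPolynomial (Fin m × Fin n) K)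
    (hr : ψ (algebraMap _ B r) ≠ 0) : Function.Injective fun t : B ⧸ J => r • t := by
  have key : ∀ t : B ⧸ J, r • t = 0 → t = 0 := by
    intro t ht
    obtain ⟨b, rfl⟩ := Ideal.Quotient.mk_surjective t
    have h1 : algebraMap _ B r * b ∈ J := by
      rw [← Ideal.Quotient.eq_zero_iff_mem, ← Algebra.smul_def]
      exact ht
    have h2 : ψ b = 0 := by
      have h3 := hJ h1
      rw [RingHom.mem_ker, map_mul] at h3
      exact (mul_eq_zero.1 h3).resolve_left hr
    have h4 := hψ b
    rw [h2, zero_sub] at h4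
    exact Ideal.Quotient.eq_zero_iff_mem.2 ((neg_mem_iff).1 h4)
  intro a b hab
  rw [← sub_eq_zero]
  apply key
  rw [smul_sub, sub_eq_zero]
  exact hab

end Regularity

theorem det_submatrix_mem_span_minors {S : Type} [CommRing S] {m n : ℕ}
    (X : Matrix (Fin m) (Fin n) S) (g : Fin n → Fin m) :
    (X.submatrix g id).det ∈ Ideal.span {p | ∃ g : Fin n → Fin m, StrictMono g ∧
      p = (X.submatrix g id).det} := by
  by_cases hg : Function.Injective g
  · have hmono : StrictMono (g ∘ Tuple.sort g) :=
      (Tuple.monotone_sort g).strictMono_of_injective (hg.comp (Tuple.sort g).injective)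
    have h1 := Matrix.det_permute (Tuple.sort g) (X.submatrix g id)
    rw [Matrix.submatrix_submatrix] at h1
    have h2 : (X.submatrix g id).det = ((Equiv.Perm.sign (Tuple.sort g) : ℤ) : S) *
        (X.submatrix (g ∘ Tuple.sort g) id).det := by
      have h3 : ((Equiv.Perm.sign (Tuple.sort g) : ℤ) : S) *
          ((Equiv.Perm.sign (Tuple.sort g) : ℤ) : S) = 1 := by
        rw [← Int.cast_mul, ← Units.val_mul, Int.units_mul_self]; simp
      rw [show (id ∘ id : Fin n → Fin n) = id from rfl] at h1
      rw [h1, ← mul_assoc, h3, one_mul]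
    rw [h2]
    exact Ideal.mul_mem_left _ _ (Ideal.subset_span ⟨_, hmono, rfl⟩)
  · obtain ⟨a, b, hab, hne⟩ : ∃ a b, g a = g b ∧ a ≠ b := by
      simpa [Function.Injective] using hg
    rw [Matrix.det_zero_of_row_eq hne (by ext j; simp [hab])]
    exact Ideal.zero_mem _

/-- Modulo the defect ideal, all maximal minors are multiples of the top one. -/
theorem span_minors_map_le (K : Type) [Field K] {m n : ℕ} (h : n ≤ m) (s : ℕ)
    (P : ℕ → Fin m × Fin n) (k : ℕ)
    (hP : ∀ (i : Fin m) (j : Fin n), n ≤ (i : ℕ) → (j : ℕ) < s → ∃ l < k, P l = (i, j))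
    {A : Type} [CommRing A] (ρ : MvPolynomial (Fin m × Fin n) K →+* A)
    (hρ : defectIdeal K h s P k ≤ RingHom.ker ρ)
    (hu : IsUnit (ρ (pivotDet h s (genMatrix K m n)))) :
    (Ideal.span {p | ∃ g : Fin n → Fin m, StrictMono g ∧
      p = ((genMatrix K m n).submatrix g id).det}).map ρ ≤
      Ideal.span {ρ ((genMatrix K m n).submatrix (Fin.castLE h) id).det} := by
  rw [Ideal.map_le_iff_le_comap, Ideal.span_le]
  rintro _ ⟨g, -, rfl⟩
  set G := genMatrix K m n
  let Y : Matrix (Fin m) (Fin n) (MvPolynomial (Fin m × Fin n) K) := Matrix.of fun i t =>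
    if (i : ℕ) < n then (if i = Fin.castLE h t then pivotDet h s G else 0)
    else pivotCoeff h s G i t
  have key : ∀ i j, ρ (pivotDet h s G * G i j) = ρ (∑ t, Y i t * G (Fin.castLE h t) j) := by
    intro i j
    by_cases hi : (i : ℕ) < n
    · congr 1
      rw [Finset.sum_eq_single ⟨i, hi⟩]
      · simp [Y, hi, Fin.ext_iff]
      · intro t _ ht
        have : i ≠ Fin.castLE h t := fun h0 =>
          ht (Fin.ext (by have := congrArg Fin.val h0; simpa using this.symm))
        simp [Y, hi, this]
      · simp
    · have h1 : ρ (pivotDefect h s G i j) = 0 := by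
        by_cases hj : (j : ℕ) < s
        · obtain ⟨l, hl, h0⟩ := hP i j (not_lt.1 hi) hj
          exact hρ (Ideal.subset_span ⟨l, hl, by rw [h0]⟩)
        · rw [pivotDefect_eq_zero h s G i j (not_lt.1 hj), map_zero]
      rw [pivotDefect, map_sub, sub_eq_zero] at h1
      simpa [Y, hi] using h1
  have h1 : ρ.mapMatrix (pivotDet h s G • G.submatrix g id) =
      ρ.mapMatrix (Y.submatrix g id * G.submatrix (Fin.castLE h) id) := by
    ext i j
    simpa [Matrix.mul_apply] using key (g i) j
  have h2 := congrArg Matrix.det h1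
  rw [← RingHom.map_det, ← RingHom.map_det, Matrix.det_smul, Matrix.det_mul, map_mul, map_mul,
    map_pow] at h2
  have h3 := hu.pow (Fintype.card (Fin n))
  change ρ _ ∈ Ideal.span _
  rw [Ideal.mem_span_singleton]
  exact (h3.dvd_mul_left).1 ⟨_, h2.trans (mul_comm _ _)⟩

section Assembly

open TensorProduct LinearMap

section

variable {S : Type} [CommRing S] {E : Type} [AddCommGroup E] [Module S E]

theorem exists_tensor_of_mem_smul_top (I : Ideal S) {Z : E} (hZ : Z ∈ (I • ⊤ : Submodule S E)) :
    ∃ z : I ⊗[S] E, rTensor E (Submodule.subtype I) z = (1 : S) ⊗ₜ Z := by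
  refine Submodule.smul_induction_on hZ (fun r hr y _ => ⟨⟨r, hr⟩ ⊗ₜ y, ?_⟩) ?_
  · rw [rTensor_tmul, ← smul_tmul, smul_eq_mul, mul_one]; rfl
  · rintro x y ⟨a, ha⟩ ⟨b, hb⟩
    exact ⟨a + b, by rw [map_add, ha, hb, tmul_add]⟩

theorem tmul_eq_zero_of_mem_smul_top {N : Type} [AddCommGroup N] [Module S N] (J : Ideal S) (x : N)
    (hx : ∀ c ∈ J, c • x = 0) {Z : E} (hZ : Z ∈ (J • ⊤ : Submodule S E)) :
    x ⊗ₜ[S] Z = 0 := by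
  refine Submodule.smul_induction_on hZ (fun r hr y _ => ?_) fun a b ha hb => ?_
  · rw [← smul_tmul, hx r hr, zero_tmul]
  · rw [tmul_add, ha, hb, add_zero]

end

theorem exists_quotient_chain_map {S B : Type} [CommRing S] [CommRing B] [Algebra S B]
    (J J' : Ideal B) (y : S) (hJ : J ≤ J') (hJ' : J' ≤ Ideal.span {algebraMap S B y} ⊔ J) :
    ∃ q : (B ⧸ J) →ₗ[S] (B ⧸ J'), Function.Surjective q ∧
      (∀ x, q x = 0 → ∃ t, x = y • t) ∧ q 1 = 1 := by
  refine ⟨(Ideal.Quotient.factorₐ S hJ).toLinearMap, Ideal.Quotient.factor_surjective hJ,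
    fun x hx => ?_, map_one (Ideal.Quotient.factorₐ S hJ)⟩
  obtain ⟨b, rfl⟩ := Ideal.Quotient.mk_surjective x
  have hb : b ∈ J' := Ideal.Quotient.eq_zero_iff_mem.1 hx
  obtain ⟨a, ha⟩ := Ideal.mem_span_singleton_sup.1 (hJ' hb)
  obtain ⟨c, hc, rfl⟩ := ha
  refine ⟨Ideal.Quotient.mk J a, ?_⟩
  rw [map_add, Ideal.Quotient.eq_zero_iff_mem.2 hc, add_zero, map_mul, mul_comm, Algebra.smul_def]
  rfl

/-- If the class of `1` is a boundary, the functional generates the unit ideal. -/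
theorem one_mem_of_boundary {S V B : Type} [CommRing S] [AddCommGroup V] [Module S V] [CommRing B]
    [Algebra S B] (ξ : Module.Dual S V) (b : Ideal S) (hξ : ∀ v, ξ v ∈ b) (J : Ideal B)
    (t : (B ⧸ J) ⊗[S] ExteriorAlgebra S V)
    (ht : lTensor (B ⧸ J) (contract ξ) t = (1 : B ⧸ J) ⊗ₜ (1 : ExteriorAlgebra S V)) :
    (1 : B) ∈ J ⊔ b.map (algebraMap S B) := by
  let J' := J ⊔ b.map (algebraMap S B)
  let f : (B ⧸ J) →ₗ[S] (B ⧸ J') :=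
    (Ideal.Quotient.factorₐ S (le_sup_left : J ≤ J')).toLinearMap
  let F : (B ⧸ J) ⊗[S] ExteriorAlgebra S V →ₗ[S] (B ⧸ J') :=
    (TensorProduct.rid S (B ⧸ J')).toLinearMap ∘ₗ
      TensorProduct.map f (ExteriorAlgebra.algebraMapInv (R := S) (M := V)).toLinearMap
  have hF : ∀ x w, F (x ⊗ₜ w) = ExteriorAlgebra.algebraMapInv w • f x := fun x w => by
    simp [F]
  have h0 : ∀ t, F (lTensor (B ⧸ J) (contract ξ) t) = 0 := by
    intro t
    induction t with
    | zero => simp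
    | add a b ha hb => rw [map_add, map_add, ha, hb, add_zero]
    | tmul x w =>
      rw [lTensor_tmul, hF, Algebra.smul_def]
      have h1 : algebraMap S (B ⧸ J') (ExteriorAlgebra.algebraMapInv (contract ξ w)) = 0 :=
        Ideal.Quotient.eq_zero_iff_mem.2 (le_sup_right (a := J)
          (Ideal.mem_map_of_mem _ (algebraMapInv_contract_mem ξ b hξ w)))
      rw [h1, zero_mul]
  have h1 : F ((1 : B ⧸ J) ⊗ₜ (1 : ExteriorAlgebra S V)) = 1 := by
    rw [hF, map_one, one_smul]
    exact map_one (Ideal.Quotient.factorₐ S (le_sup_left : J ≤ J'))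
  rw [← ht, h0] at h1
  exact Ideal.Quotient.eq_zero_iff_mem.1 (h1.symm.trans rfl : (Ideal.Quotient.mk J' 1) = 0)

/-- The product `v (k - 1) * ⋯ * v 0` in the exterior algebra. -/
noncomputable def wedgeSeq {S V : Type} [CommRing S] [AddCommGroup V] [Module S V] (v : ℕ → V) :
    ℕ → ExteriorAlgebra S V
  | 0 => 1
  | k + 1 => ExteriorAlgebra.ι S (v k) * wedgeSeq v k

theorem contract_wedgeSeq_mem {S V : Type} [CommRing S] [AddCommGroup V] [Module S V] (v : ℕ → V)
    (ψ : Module.Dual S V) (J : Ideal S) (k : ℕ) (h : ∀ l < k, ψ (v l) ∈ J) :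
    contract ψ (wedgeSeq v k) ∈ (J • ⊤ : Submodule S (ExteriorAlgebra S V)) := by
  induction k with
  | zero => rw [wedgeSeq, contract_one]; exact zero_mem _
  | succ k ih =>
    rw [wedgeSeq, contract_ι_mul]
    exact sub_mem (Submodule.smul_mem_smul (h k (by omega)) Submodule.mem_top)
      (mul_mem_smul_top_left J _ (ih fun l hl => h l (by omega)))

theorem exists_enumeration {m n s : ℕ} (hmn : n < m) (hsn : s ≤ n) (hs : 1 ≤ s) :
    ∃ P : ℕ → Fin m × Fin n,
      (∀ l < s * (m - n), n ≤ ((P l).1 : ℕ) ∧ ((P l).2 : ℕ) < s) ∧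
      (∀ l l', P l = P l' → l < s * (m - n) → l' < s * (m - n) → l = l') ∧
      ∀ (i : Fin m) (j : Fin n), n ≤ (i : ℕ) → (j : ℕ) < s → ∃ l < s * (m - n), P l = (i, j) := by
  have hpos : 0 < m - n := by omega
  have hdiv : ∀ l < s * (m - n), l / (m - n) < s := fun l hl =>
    (Nat.div_lt_iff_lt_mul hpos).2 hl
  refine ⟨fun l => (⟨n + l % (m - n), by have := Nat.mod_lt l hpos; omega⟩,
    ⟨(l / (m - n)) % n, Nat.mod_lt _ (by omega)⟩), ?_, ?_, ?_⟩
  · intro l hl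
    have := hdiv l hl
    exact ⟨by simp, by simpa [Nat.mod_eq_of_lt (this.trans_le hsn)] using this⟩
  · intro l l' h hl hl'
    simp only [Prod.mk.injEq, Fin.mk.injEq, Nat.add_left_cancel_iff] at h
    rw [Nat.mod_eq_of_lt ((hdiv l hl).trans_le hsn),
      Nat.mod_eq_of_lt ((hdiv l' hl').trans_le hsn)] at h
    rw [← Nat.div_add_mod l (m - n), ← Nat.div_add_mod l' (m - n), h.1, h.2]
  · intro i j hi hj
    have hi' := i.2
    have h1 : (i : ℕ) - n < m - n := by omega
    refine ⟨j * (m - n) + (i - n), ?_, ?_⟩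
    · calc (j : ℕ) * (m - n) + (i - n) < j * (m - n) + (m - n) := by omega
        _ = (j + 1) * (m - n) := by ring
        _ ≤ s * (m - n) := Nat.mul_le_mul_right _ hj
    · have h2 : ((j : ℕ) * (m - n) + (i - n)) % (m - n) = i - n := by
        rw [Nat.mul_add_mod', Nat.mod_eq_of_lt h1]
      have h3 : ((j : ℕ) * (m - n) + (i - n)) / (m - n) = j := by
        rw [mul_comm, Nat.mul_add_div hpos, Nat.div_eq_of_lt h1, add_zero]
      refine Prod.ext (Fin.ext ?_) (Fin.ext ?_)
      · simp only [h2]; omega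
      · simp only [h3]; exact Nat.mod_eq_of_lt j.2

end Assembly

section Functionals

variable (K : Type) [Field K] {m n : ℕ} (h : n ≤ m) (s : ℕ)

/-- The functional on the `k`-th block given by the `j`-th column of the generic matrix. -/
noncomputable def columnFunctional (m n k : ℕ) (j : Fin n) :
    Module.Dual (MvPolynomial (Fin m × Fin n) K)
      ((Fin m × ℕ) →₀ MvPolynomial (Fin m × Fin n) K) :=
  ∑ i, genMatrix K m n i j • Finsupp.lapply (i, k)

theorem columnFunctional_single (k : ℕ) (j : Fin n) (i : Fin m) (b : ℕ) :
    columnFunctional K m n k j (Finsupp.single (i, b) 1) =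
      if b = k then genMatrix K m n i j else 0 := by
  classical
  rw [columnFunctional, LinearMap.sum_apply, Finset.sum_eq_single i]
  · simp [Finsupp.single_apply]
  · intro l _ hl
    simp [hl.symm]
  · simp

/-- The Cramer relation of row `i`, placed in the block `j`. -/
noncomputable def relationVector (ij : Fin m × Fin n) :
    (Fin m × ℕ) →₀ MvPolynomial (Fin m × Fin n) K :=
  pivotDet h s (genMatrix K m n) • Finsupp.single (ij.1, (ij.2 : ℕ)) 1 -
    ∑ t, pivotCoeff h s (genMatrix K m n) ij.1 t •
      Finsupp.single (Fin.castLE h t, (ij.2 : ℕ)) 1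

theorem columnFunctional_relationVector (k : ℕ) (j : Fin n) (ij : Fin m × Fin n) :
    columnFunctional K m n k j (relationVector K h s ij) =
      if (ij.2 : ℕ) = k then pivotDefect h s (genMatrix K m n) ij.1 j else 0 := by
  simp only [relationVector, map_sub, map_sum, map_smul, columnFunctional_single, smul_eq_mul]
  split_ifs <;> simp [pivotDefect]

theorem sum_columnFunctional_relationVector (c : ℕ → Fin n) (ij : Fin m × Fin n)
    (hij : (ij.2 : ℕ) < s) (hc : c (ij.2 : ℕ) = ij.2) :
    (∑ k ∈ Finset.range s, columnFunctional K m n k (c k)) (relationVector K h s ij) =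
      pivotDefect h s (genMatrix K m n) ij.1 ij.2 := by
  rw [LinearMap.sum_apply, Finset.sum_eq_single (ij.2 : ℕ)]
  · rw [columnFunctional_relationVector, if_pos rfl, hc]
  · intro k _ hk
    rw [columnFunctional_relationVector, if_neg hk.symm]
  · exact fun h0 => absurd (Finset.mem_range.2 hij) h0

theorem sum_columnFunctional_mem (c : ℕ → Fin n) (hc : ∀ k < s, (c k : ℕ) < s)
    (v : (Fin m × ℕ) →₀ MvPolynomial (Fin m × Fin n) K) :
    (∑ k ∈ Finset.range s, columnFunctional K m n k (c k)) v ∈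
      Ideal.span {f : MvPolynomial (Fin m × Fin n) K |
        ∃ (i : Fin m) (j : Fin n), (j : ℕ) < s ∧ f = X (i, j)} := by
  rw [LinearMap.sum_apply]
  refine sum_mem fun k hk => ?_
  rw [columnFunctional, LinearMap.sum_apply]
  refine sum_mem fun i _ => ?_
  exact Ideal.mul_mem_right _ _ (Ideal.subset_span ⟨i, c k, hc k (Finset.mem_range.1 hk), rfl⟩)

theorem flat_exteriorAlgebra_finsupp (S : Type) [CommRing S] (m : ℕ) :
    Module.Flat S (ExteriorAlgebra S ((Fin m × ℕ) →₀ S)) := by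
  have b : Module.Basis (Fin m ×ₗ ℕ) S ((Fin m × ℕ) →₀ S) :=
    Finsupp.basisSingleOne.reindex toLex
  have := Module.Free.of_basis b.ExteriorAlgebra
  infer_instance

end Functionals

section Chain

variable (K : Type) [Field K] {m n : ℕ} (h : n ≤ m) (s : ℕ) (P : ℕ → Fin m × Fin n)

theorem pivotDefect_smul_injective (B : Type) [CommRing B] [IsDomain B]
    [Algebra (MvPolynomial (Fin m × Fin n) K) B]
    [IsLocalization.Away (pivotDet h s (genMatrix K m n)) B] (p k : ℕ) (hk : k < p)
    (hP : ∀ l < p, n ≤ ((P l).1 : ℕ) ∧ ((P l).2 : ℕ) < s)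
    (hP' : ∀ l l', P l = P l' → l < p → l' < p → l = l')
    (hB : Function.Injective (algebraMap (MvPolynomial (Fin m × Fin n) K) B)) :
    Function.Injective fun t : B ⧸ (defectIdeal K h s P k).map
        (algebraMap (MvPolynomial (Fin m × Fin n) K) B) =>
      pivotDefect h s (genMatrix K m n) (P k).1 (P k).2 • t := by
  obtain ⟨ψ, hψ, hψ1, hψ2⟩ := exists_retraction K h s P B k fun l hl => hP l (hl.trans hk)
  refine smul_injective_of_map_ne_zero K B _ ψ hψ1 hψ2 _ ?_
  have key : ψ (algebraMap _ B (pivotDefect h s (genMatrix K m n) (P k).1 (P k).2)) =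
      algebraMap _ B (pivotDefect h s (genMatrix K m n) (P k).1 (P k).2) := by
    have h1 : ∀ (i : Fin m) (j : Fin n), s ≤ (j : ℕ) →
        ((genMatrix K m n).map (algebraMap _ B)).map ψ i j =
          (genMatrix K m n).map (algebraMap _ B) i j := by
      intro i j hj
      refine hψ i j fun l hl h0 => ?_
      have := (hP l (hl.trans hk)).2
      rw [h0] at this
      exact absurd this (not_lt.2 hj)
    rw [map_pivotDefect, map_pivotDefect]
    simp only [pivotDefect, pivotDet_congr h s h1, pivotCoeff_congr h s h1]
    congr 1
    · congr 1
      exact hψ _ _ fun l hl h0 => (hl.ne (hP' l k h0 (hl.trans hk) hk)).elim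
    · refine Finset.sum_congr rfl fun t _ => ?_
      congr 1
      refine hψ _ _ fun l hl h0 => ?_
      have := (hP l (hl.trans hk)).1
      rw [h0] at this
      exact absurd this (not_le.2 (by simp))
  rw [key]
  exact (map_ne_zero_iff _ hB).2
    (pivotDefect_genMatrix_ne_zero K h s _ _ (hP k hk).1 (hP k hk).2)

theorem det_top_pow_smul_injective (B : Type) [CommRing B] [IsDomain B]
    [Algebra (MvPolynomial (Fin m × Fin n) K) B]
    [IsLocalization.Away (pivotDet h s (genMatrix K m n)) B] (p d : ℕ)
    (hP : ∀ l < p, n ≤ ((P l).1 : ℕ) ∧ ((P l).2 : ℕ) < s)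
    (hB : Function.Injective (algebraMap (MvPolynomial (Fin m × Fin n) K) B)) :
    Function.Injective fun t : B ⧸ (defectIdeal K h s P p).map
        (algebraMap (MvPolynomial (Fin m × Fin n) K) B) =>
      ((genMatrix K m n).submatrix (Fin.castLE h) id).det ^ d • t := by
  obtain ⟨ψ, hψ, hψ1, hψ2⟩ := exists_retraction K h s P B p hP
  refine smul_injective_of_map_ne_zero K B _ ψ hψ1 hψ2 _ ?_
  have key : ψ (algebraMap _ B ((genMatrix K m n).submatrix (Fin.castLE h) id).det) =
      algebraMap _ B ((genMatrix K m n).submatrix (Fin.castLE h) id).det := by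
    rw [RingHom.map_det, RingHom.map_det]
    congr 1
    ext t j
    refine hψ _ _ fun l hl h0 => ?_
    have := (hP l hl).1
    rw [h0] at this
    exact absurd this (not_le.2 (by simp))
  rw [map_pow, map_pow, key]
  exact pow_ne_zero _ ((map_ne_zero_iff _ hB).2 (det_top_genMatrix_ne_zero K h))

theorem one_notMem_map_span_X (B : Type) [CommRing B] [Nontrivial B]
    [Algebra (MvPolynomial (Fin m × Fin n) K) B]
    [IsLocalization.Away (pivotDet h s (genMatrix K m n)) B] :
    (1 : B) ∉ (Ideal.span {f : MvPolynomial (Fin m × Fin n) K |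
      ∃ (i : Fin m) (j : Fin n), (j : ℕ) < s ∧ f = X (i, j)}).map
        (algebraMap (MvPolynomial (Fin m × Fin n) K) B) := by
  obtain ⟨ψ, hψ, -⟩ := exists_substitution K h s B
    (Matrix.of fun i j => if s ≤ (j : ℕ) then
      algebraMap (MvPolynomial (Fin m × Fin n) K) B (X (i, j)) else 0)
    (fun i j hj => by simp [hj]) ⊤ (fun _ _ => Submodule.mem_top)
  intro h1
  have h2 : (Ideal.span {f : MvPolynomial (Fin m × Fin n) K |
      ∃ (i : Fin m) (j : Fin n), (j : ℕ) < s ∧ f = X (i, j)}).map (algebraMap _ B) ≤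
        RingHom.ker ψ := by
    rw [Ideal.map_le_iff_le_comap, Ideal.span_le]
    rintro _ ⟨i, j, hj, rfl⟩
    have := congrFun (congrFun hψ i) j
    rw [Matrix.of_apply, if_neg (not_le.2 hj)] at this
    exact this
  have h3 : ψ 1 = 0 := h2 h1
  rw [map_one] at h3
  exact one_ne_zero h3

theorem exists_minor_cycle [CharZero K] (d : ℕ) (hsd : s ≤ d) (p : ℕ) (c : ℕ → Fin n)
    (hPs : ∀ (i : Fin m) (j : Fin n), n ≤ (i : ℕ) → (j : ℕ) < s → ∃ l < p, P l = (i, j))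
    (hP : ∀ l < p, n ≤ ((P l).1 : ℕ) ∧ ((P l).2 : ℕ) < s) :
    ∃ Z ∈ ((Ideal.span {p | ∃ g : Fin n → Fin m, StrictMono g ∧
        p = ((genMatrix K m n).submatrix g id).det}) ^ d • ⊤ :
          Submodule (MvPolynomial (Fin m × Fin n) K) (ExteriorAlgebra _ _)),
      contract (∑ k ∈ Finset.range s, columnFunctional K m n k (c k)) Z = 0 ∧
      Z - ((genMatrix K m n).submatrix (Fin.castLE h) id).det ^ d •
        wedgeSeq (fun l => relationVector K h s (P l)) p ∈
          (defectIdeal K h s P p • ⊤ : Submodule (MvPolynomial (Fin m × Fin n) K) _) := by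
  classical
  set δ := ((genMatrix K m n).submatrix (Fin.castLE h) id).det
  set I := Ideal.span {p | ∃ g : Fin n → Fin m, StrictMono g ∧
        p = ((genMatrix K m n).submatrix g id).det} with hI
  have hfac : IsUnit ((n.factorial : ℕ) : MvPolynomial (Fin m × Fin n) K) := by
    rw [← map_natCast (C : K →+* MvPolynomial (Fin m × Fin n) K)]
    exact (IsUnit.mk0 _ (Nat.cast_ne_zero.2 n.factorial_ne_zero)).map _
  obtain ⟨ω, hω, hω0, r, hr, hωU⟩ := exists_contract_cycle s I (defectIdeal K h s P p)
    (columnFunctional K m n) (fun k t => Finsupp.single (Fin.castLE h t, k) 1)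
    ((genMatrix K m n).submatrix (Fin.castLE h) id) c
    (wedgeSeq (fun l => relationVector K h s (P l)) p)
    (fun k => alternatingMap_sum_mem (ExteriorAlgebra.ιMulti _ n) (genMatrix K m n) I
      (det_submatrix_mem_span_minors _) hfac _)
    (fun k j t => by rw [columnFunctional_single, if_pos rfl]; rfl)
    (fun k k' hk j t => by rw [columnFunctional_single, if_neg hk.symm])
    (fun k j => contract_wedgeSeq_mem _ _ _ _ fun l hl => by
      rw [columnFunctional_relationVector]
      split_ifs with h0
      · by_cases hj : (j : ℕ) < s
        · obtain ⟨l', hl', h1⟩ := hPs (P l).1 j (hP l hl).1 hj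
          exact Ideal.subset_span ⟨l', hl', by rw [h1]⟩
        · rw [pivotDefect_eq_zero _ _ _ _ _ (not_lt.1 hj)]
          exact zero_mem _
      · exact zero_mem _)
  obtain ⟨r', hr'⟩ := hr.exists_left_inv
  refine ⟨(r' * δ ^ (d - s)) • ω, ?_, ?_, ?_⟩
  · have hI' : (I ^ d • ⊤ : Submodule (MvPolynomial (Fin m × Fin n) K) (ExteriorAlgebra
        (MvPolynomial (Fin m × Fin n) K) ((Fin m × ℕ) →₀ MvPolynomial (Fin m × Fin n) K))) =
        I ^ (d - s) • I ^ s • ⊤ := by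
      rw [← Submodule.mul_smul, ← pow_add, Nat.sub_add_cancel hsd]
    rw [mul_smul, hI']
    exact Submodule.smul_mem _ _ (Submodule.smul_mem_smul
      (Ideal.pow_mem_pow (det_submatrix_mem_span_minors _ _) _) hω)
  · rw [map_smul, hω0, smul_zero]
  · convert Submodule.smul_mem _ (r' * δ ^ (d - s)) hωU using 1
    rw [smul_sub, smul_smul]
    congr 2
    calc δ ^ d = (r' * r) * (δ ^ (d - s) * δ ^ s) := by
          rw [hr', one_mul, ← pow_add, Nat.sub_add_cancel hsd]
      _ = _ := by ring

end Chain

theorem ExtVanish.of_linearEquiv {R N N' : Type} [CommRing R] [AddCommGroup N] [Module R N]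
    [AddCommGroup N'] [Module R N'] (e : N ≃ₗ[R] N') (p : ℕ) :
    ∀ (M : Type) [AddCommGroup M] [Module R M], ExtVanish R N p M → ExtVanish R N' p M := by
  induction p with
  | succ p ih => exact fun M _ _ h k f hf => ih _ (h k f hf)
  | zero =>
    intro M _ _ h k f hf g
    obtain ⟨g', hg'⟩ := h k f hf (e.symm.toLinearMap ∘ₗ g)
    exact ⟨e.toLinearMap ∘ₗ g', fun x => by simp [hg']⟩

section Main

open TensorProduct LinearMap

variable (K : Type) [Field K] [CharZero K] {m n : ℕ}

theorem not_extVanish_localization_span_minors_pow (B : Type) [CommRing B] [IsDomain B]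
    [Algebra (MvPolynomial (Fin m × Fin n) K) B] (hmn : n < m) (s d p : ℕ) (hs : 1 ≤ s)
    (hsn : s ≤ n) (hd : n ≤ d) (hp : p + 1 = s * (m - n))
    [IsLocalization.Away (pivotDet hmn.le s (genMatrix K m n)) B]
    (hB : Function.Injective (algebraMap (MvPolynomial (Fin m × Fin n) K) B)) :
    ¬ ExtVanish (MvPolynomial (Fin m × Fin n) K) B p
      ((Ideal.span {p | ∃ g : Fin n → Fin m, StrictMono g ∧
        p = ((genMatrix K m n).submatrix g _root_.id).det} ^ d :
          Ideal (MvPolynomial (Fin m × Fin n) K)) :) := by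
  intro hE
  obtain ⟨P, hP, hP', hPs⟩ := exists_enumeration hmn hsn hs
  rw [← hp] at hP hP' hPs
  have h : n ≤ m := hmn.le
  let J : ℕ → Ideal B := fun k =>
    (defectIdeal K h s P k).map (algebraMap (MvPolynomial (Fin m × Fin n) K) B)
  let V := (Fin m × ℕ) →₀ (MvPolynomial (Fin m × Fin n) K)
  have : Module.Flat (MvPolynomial (Fin m × Fin n) K)
      (ExteriorAlgebra (MvPolynomial (Fin m × Fin n) K) V) :=
    flat_exteriorAlgebra_finsupp _ m
  let c : ℕ → Fin n := fun k => ⟨k % n, Nat.mod_lt _ (by omega)⟩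
  have hc : ∀ k < s, (c k : ℕ) = k := fun k hk => Nat.mod_eq_of_lt (hk.trans_le hsn)
  let ξ : Module.Dual (MvPolynomial (Fin m × Fin n) K) V :=
    ∑ k ∈ Finset.range s, columnFunctional K m n k (c k)
  let v : ℕ → V := fun l => relationVector K h s (P l)
  let y : ℕ → MvPolynomial (Fin m × Fin n) K := fun l =>
    pivotDefect h s (genMatrix K m n) (P l).1 (P l).2
  let δ : MvPolynomial (Fin m × Fin n) K :=
    ((genMatrix K m n).submatrix (Fin.castLE h) _root_.id).det
  let u : ∀ k, (B ⧸ J k) ⊗[MvPolynomial (Fin m × Fin n) K]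
      ExteriorAlgebra (MvPolynomial (Fin m × Fin n) K) V := fun k => 1 ⊗ₜ wedgeSeq v k
  let u₁ : ∀ k, (B ⧸ J k) ⊗[MvPolynomial (Fin m × Fin n) K]
      ExteriorAlgebra (MvPolynomial (Fin m × Fin n) K) V := fun k => 1 ⊗ₜ wedgeSeq v (k + 1)
  have hξv : ∀ l ≤ p, ξ (v l) = y l := fun l hl =>
    sum_columnFunctional_relationVector K h s c (P l) (hP l (by omega)).2
      (Fin.ext (hc _ (hP l (by omega)).2))
  have hkill : ∀ k, ∀ a ∈ defectIdeal K h s P k, a • (1 : B ⧸ J k) = 0 := by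
    intro k a ha
    rw [Algebra.smul_def, mul_one]
    exact Ideal.Quotient.eq_zero_iff_mem.2 (Ideal.mem_map_of_mem _ ha)
  have hmono : ∀ k, defectIdeal K h s P k ≤ defectIdeal K h s P (k + 1) := fun k =>
    Ideal.span_mono fun f ⟨l, hl, hf⟩ => ⟨l, by omega, hf⟩
  have hsucc : ∀ k, J (k + 1) ≤
      Ideal.span {algebraMap (MvPolynomial (Fin m × Fin n) K) B (y k)} ⊔ J k := by
    intro k
    rw [Ideal.map_le_iff_le_comap, defectIdeal, Ideal.span_le]
    rintro _ ⟨l, hl, rfl⟩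
    obtain hl | rfl := Nat.lt_succ_iff_lt_or_eq.1 hl
    · exact le_sup_right (a := Ideal.span {algebraMap (MvPolynomial (Fin m × Fin n) K) B (y k)})
        (Ideal.mem_map_of_mem _ (Ideal.subset_span ⟨l, hl, rfl⟩))
    · exact le_sup_left (b := J l) (Ideal.subset_span rfl)
  choose q hq hker hq1 using fun k => exists_quotient_chain_map (J k) (J (k + 1)) (y k)
    (Ideal.map_mono (hmono k)) (hsucc k)
  obtain ⟨Z, hZ, hZ0, hZU⟩ := exists_minor_cycle K h s P d (hsn.trans hd) (p + 1) c hPs hP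
  set I : Ideal (MvPolynomial (Fin m × Fin n) K) :=
    Ideal.span {p | ∃ g : Fin n → Fin m, StrictMono g ∧
      p = ((genMatrix K m n).submatrix g _root_.id).det} with hI
  obtain ⟨z, hz⟩ := exists_tensor_of_mem_smul_top (I ^ d) hZ
  have hz0 : lTensor _ (contract ξ) z = 0 := by
    apply Module.Flat.rTensor_preserves_injective_linearMap
      (M := ExteriorAlgebra (MvPolynomial (Fin m × Fin n) K) V)
      (Submodule.subtype (I ^ d)) (Submodule.injective_subtype _)
    rw [rTensor_lTensor_comm, hz, lTensor_tmul, hZ0, tmul_zero, map_zero]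
  have hδ := det_top_pow_smul_injective K h s P B (p + 1) d hP hB
  obtain ⟨π, hπ⟩ := exists_linearMap_eq_smul (δ ^ d) hδ
    (Algebra.linearMap (MvPolynomial (Fin m × Fin n) K) (B ⧸ J (p + 1)) ∘ₗ
      Submodule.subtype (I ^ d)) (by
      rintro ⟨x, hx⟩
      have h1 := span_minors_map_le K h s P (p + 1) hPs
        (algebraMap (MvPolynomial (Fin m × Fin n) K) (B ⧸ J (p + 1)))
        (fun a ha => by
          rw [RingHom.mem_ker]
          exact (Algebra.algebraMap_eq_smul_one _).trans (hkill _ a ha))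
        ((IsLocalization.Away.algebraMap_isUnit (S := B)
          (pivotDet h s (genMatrix K m n))).map (Ideal.Quotient.mk _))
      have h2 := Ideal.pow_right_mono h1 d (Ideal.map_pow
        (algebraMap (MvPolynomial (Fin m × Fin n) K) (B ⧸ J (p + 1))) I d ▸
        Ideal.mem_map_of_mem _ hx)
      rw [Ideal.span_singleton_pow, Ideal.mem_span_singleton] at h2
      obtain ⟨t, ht⟩ := h2
      exact ⟨t, by rw [Algebra.smul_def, map_pow]; exact ht⟩)
  have hπz : rTensor _ π z = u (p + 1) + lTensor _ (contract ξ) 0 := by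
    rw [map_zero, add_zero]
    apply smul_tensor_injective (δ ^ d) hδ
    change δ ^ d • rTensor _ π z = δ ^ d • u (p + 1)
    rw [← LinearMap.smul_apply, ← rTensor_smul, ← hπ, rTensor_comp_apply, hz, rTensor_tmul,
      Algebra.linearMap_apply, map_one, ← tmul_smul, ← sub_eq_zero, ← tmul_sub]
    exact tmul_eq_zero_of_mem_smul_top (defectIdeal K h s P (p + 1)) _ (hkill _) hZU
  have hJ0 : J 0 = ⊥ := by simp [J, defectIdeal]
  have hE0 : ExtVanish (MvPolynomial (Fin m × Fin n) K) (B ⧸ J 0) p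
      (I ^ d : Ideal (MvPolynomial (Fin m × Fin n) K)) :=
    ExtVanish.of_linearEquiv (((AlgEquiv.quotientBot (MvPolynomial (Fin m × Fin n) K) B).symm.trans
      (Ideal.quotientEquivAlgOfEq (MvPolynomial (Fin m × Fin n) K) hJ0.symm)).toLinearEquiv) p _ hE
  obtain ⟨t, ht⟩ := mem_range_of_extVanish (contract ξ) (contract_mul_self ξ)
    (fun k => B ⧸ J k) y q u u₁ p
    (fun k hk => pivotDefect_smul_injective K h s P B (p + 1) k (by omega) hP hP' hB)
    (fun k _ => hq k) (fun k _ => hker k)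
    (fun k _ => by rw [rTensor_tmul, hq1])
    (fun k hk => by
      have hmem : ExteriorAlgebra.ι _ (v k) * contract ξ (wedgeSeq v k) ∈
          (defectIdeal K h s P k • ⊤ : Submodule (MvPolynomial (Fin m × Fin n) K) _) := by
        refine mul_mem_smul_top_left _ _ (contract_wedgeSeq_mem _ _ _ _ fun l hl => ?_)
        rw [hξv l (by omega)]
        exact Ideal.subset_span ⟨l, hl, rfl⟩
      rw [lTensor_tmul, wedgeSeq, contract_ι_mul, tmul_sub, hξv k hk, tmul_smul,
        tmul_eq_zero_of_mem_smul_top (defectIdeal K h s P k) _ (hkill k) hmem, sub_zero])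
    _ z π 0 hE0 hz0 hπz
  have h1 := one_mem_of_boundary ξ _
    (sum_columnFunctional_mem K s c fun k hk => (hc k hk).trans_lt hk) (J 0) t ht
  rw [hJ0, bot_sup_eq] at h1
  exact one_notMem_map_span_X K h s B h1

theorem not_extVanish_span_minors_pow (hmn : n < m) (s d p : ℕ) (hs : 1 ≤ s) (hsn : s ≤ n)
    (hd : n ≤ d) (hp : p + 1 = s * (m - n)) :
    ¬ ExtVanish (MvPolynomial (Fin m × Fin n) K) (MvPolynomial (Fin m × Fin n) K) p
      ((Ideal.span {p | ∃ g : Fin n → Fin m, StrictMono g ∧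
        p = ((genMatrix K m n).submatrix g _root_.id).det} ^ d :
          Ideal (MvPolynomial (Fin m × Fin n) K)) :) := by
  intro hE
  have hW : Submonoid.powers (pivotDet hmn.le s (genMatrix K m n)) ≤
      nonZeroDivisors (MvPolynomial (Fin m × Fin n) K) :=
    powers_le_nonZeroDivisors_of_noZeroDivisors (pivotDet_genMatrix_ne_zero K hmn.le s)
  have : IsDomain (Localization.Away (pivotDet hmn.le s (genMatrix K m n))) :=
    IsLocalization.isDomain_localization hW
  exact not_extVanish_localization_span_minors_pow K
    (Localization.Away (pivotDet hmn.le s (genMatrix K m n))) hmn s d p hs hsn hd hp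
    (IsLocalization.injective _ hW) (ExtVanish.localization _ hW _ p _ hE)

end Main

/-- For `d ≥ n`, the modules `Ext^{s(m-n)}_S(I^d, S)` are nonzero for all `0 ≤ s ≤ n`,
where `I` is the ideal of maximal minors of the generic `m × n` matrix. -/
theorem ext_powers_maximal_minors_nonvanishing
    (K : Type) [Field K] [CharZero K] (m n : ℕ) (hn : 1 ≤ n) (hmn : n < m)
    (X : Matrix (Fin m) (Fin n) (MvPolynomial (Fin m × Fin n) K))
    (hX : ∀ i j, X i j = MvPolynomial.X (i, j))
    (I : Ideal (MvPolynomial (Fin m × Fin n) K))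
    (hI : I = Ideal.span {p | ∃ g : Fin n → Fin m, StrictMono g ∧
      p = (X.submatrix g id).det})
    (d : ℕ) (hd : n ≤ d) (s : ℕ) (hsn : s ≤ n) :
    Nontrivial
      (((Ext (MvPolynomial (Fin m × Fin n) K) (ModuleCat (MvPolynomial (Fin m × Fin n) K))
            (s * (m - n))).obj
          (Opposite.op (ModuleCat.of (MvPolynomial (Fin m × Fin n) K) (↥(I ^ d))))).obj
        (ModuleCat.of (MvPolynomial (Fin m × Fin n) K) (MvPolynomial (Fin m × Fin n) K))) := by
  obtain rfl : X = genMatrix K m n := by ext1 i j; exact hX i j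
  subst hI
  by_contra hsub
  rw [not_nontrivial_iff_subsingleton] at hsub
  obtain ⟨p, hp⟩ | hp : (∃ p, s * (m - n) = p + 1) ∨ s * (m - n) = 0 := by
    cases s * (m - n) <;> simp
  · have hs : 1 ≤ s := by
      rcases s with _ | s
      · simp at hp
      · omega
    rw [hp] at hsub
    exact not_extVanish_span_minors_pow K hmn s d p hs hsn hd hp.symm
      (extVanish_of_abelianExt p _ (abelianExt_subsingleton p hsub))
  · rw [hp] at hsub
    have h0 := hom_eq_zero_of_subsingleton_ext_zero hsub (ModuleCat.ofHom (Submodule.subtype _))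
    have hmem := Ideal.pow_mem_pow
      (det_submatrix_mem_span_minors (genMatrix K m n) (Fin.castLE hmn.le)) d
    have h1 := LinearMap.congr_fun (congrArg ModuleCat.Hom.hom h0) ⟨_, hmem⟩
    exact pow_ne_zero d (det_top_genMatrix_ne_zero K hmn.le) h1
end

section
/- For every integer d ≥ 1: every S-linear map I^d → S is multiplication by a unique element of S (equivalently, the natural map S → Hom_S(I^d, S) sending f to the multiplication-by-f map is bijective), and moreover Ext^1_S(S/I^d, S) = 0. -/
open MvPolynomial

/-- A linear form `x` on `N` that is trivial on `ker i` extends along `i : N → P`, as soon as the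
cokernel of `i` is annihilated by two relatively prime nonzero elements `a`, `b`. -/
theorem exists_linearMap_comp_eq_of_isRelPrime {R N P : Type*} [CommRing R] [IsDomain R]
    [DecompositionMonoid R] [AddCommGroup N] [Module R N] [AddCommGroup P] [Module R P]
    {a b : R} (ha : a ≠ 0) (hab : IsRelPrime a b) (i : N →ₗ[R] P)
    (hai : ∀ p : P, ∃ u, i u = a • p) (hbi : ∀ p : P, ∃ u, i u = b • p)
    (x : N →ₗ[R] R) (hx : ∀ u, i u = 0 → x u = 0) :
    ∃ y : P →ₗ[R] R, y ∘ₗ i = x := by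
  have hx_eq {u v : N} (h : i u = i v) : x u = x v :=
    sub_eq_zero.1 (by rw [← map_sub]; exact hx _ (by rw [map_sub, h, sub_self]))
  choose u hu using hai
  choose v hv using hbi
  have hdvd (p : P) : a ∣ x (u p) := by
    refine hab.dvd_of_dvd_mul_left ⟨x (v p), ?_⟩
    rw [← smul_eq_mul, ← smul_eq_mul, ← map_smul, ← map_smul]
    exact hx_eq (by rw [map_smul, map_smul, hu, hv, smul_comm])
  choose y hy using hdvd
  refine ⟨{ toFun := y, map_add' := fun p q => ?_, map_smul' := fun r p => ?_ }, ?_⟩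
  · refine mul_left_cancel₀ ha ?_
    rw [mul_add, ← hy, ← hy, ← hy, ← map_add]
    exact hx_eq (by simp only [map_add, hu, smul_add])
  · refine mul_left_cancel₀ ha ?_
    rw [RingHom.id_apply, smul_eq_mul, mul_left_comm, ← hy, ← hy, ← smul_eq_mul, ← map_smul]
    exact hx_eq (by rw [map_smul, hu, hu, smul_comm])
  · ext w
    refine mul_left_cancel₀ ha ?_
    simp only [LinearMap.comp_apply, LinearMap.coe_mk, AddHom.coe_mk]
    rw [← hy, ← smul_eq_mul, ← map_smul]
    exact hx_eq (by rw [hu, map_smul])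

/-- If an ideal of a domain contains two relatively prime nonzero elements, then every linear form
on it is multiplication by a unique ring element. -/
theorem Ideal.bijective_smul_subtype_of_isRelPrime {R : Type*} [CommRing R] [IsDomain R]
    [DecompositionMonoid R] {a b : R} (ha : a ≠ 0) (hab : IsRelPrime a b) {J : Ideal R}
    (haJ : a ∈ J) (hbJ : b ∈ J) :
    Function.Bijective (fun f : R => (f • J.subtype : J →ₗ[R] R)) := by
  refine ⟨fun f g h => ?_, fun x => ?_⟩
  · have := LinearMap.congr_fun h ⟨a, haJ⟩
    exact mul_right_cancel₀ ha (by simpa using this)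
  · obtain ⟨y, hy⟩ := exists_linearMap_comp_eq_of_isRelPrime ha hab J.subtype
      (fun p => ⟨⟨a * p, J.mul_mem_right p haJ⟩, rfl⟩)
      (fun p => ⟨⟨b * p, J.mul_mem_right p hbJ⟩, rfl⟩) x
      (fun u hu => by rw [show u = 0 from Subtype.ext hu, map_zero])
    refine ⟨y 1, ?_⟩
    ext w
    rw [← hy]
    simp only [LinearMap.smul_apply, LinearMap.comp_apply, Submodule.subtype_apply, smul_eq_mul]
    conv_rhs => rw [← mul_one (w : R), ← smul_eq_mul, map_smul, smul_eq_mul]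
    exact mul_comm _ _

open CategoryTheory in
/-- `Ext¹(M, R)` vanishes when `M` is annihilated by two relatively prime nonzero elements. -/
theorem subsingleton_ext_one_of_isRelPrime {R : Type} [CommRing R] [IsDomain R]
    [DecompositionMonoid R] {a b : R} (ha : a ≠ 0) (hab : IsRelPrime a b) (M : ModuleCat.{0} R)
    (haM : ∀ z : M, a • z = 0) (hbM : ∀ z : M, b • z = 0) :
    Subsingleton (((Ext R (ModuleCat R) 1).obj (Opposite.op M)).obj (ModuleCat.of R R)) := by
  let P := projectiveResolution M
  rw [← ModuleCat.isZero_iff_subsingleton]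
  refine Limits.IsZero.of_iso ?_ (P.isoExt 1 (ModuleCat.of R R))
  rw [← HomologicalComplex.exactAt_iff_isZero_homology,
    HomologicalComplex.exactAt_iff' _ 0 1 2 (by simp) (by simp), ShortComplex.moduleCat_exact_iff]
  intro (x : P.complex.X 1 ⟶ ModuleCat.of R R) hx
  replace hx : P.complex.d 2 1 ≫ x = 0 := hx
  have hrange (c : R) (hc : ∀ z : M, c • z = 0) (p : P.complex.X 0) :
      ∃ u, (P.complex.d 1 0).hom u = c • p := by
    refine (ShortComplex.moduleCat_exact_iff _).1 P.exact₀ (c • p) ?_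
    rw [map_smul]
    exact hc _
  obtain ⟨y, hy⟩ := exists_linearMap_comp_eq_of_isRelPrime ha hab (P.complex.d 1 0).hom
    (hrange a haM) (hrange b hbM) x.hom (fun u hu => by
      obtain ⟨w, rfl⟩ := (ShortComplex.moduleCat_exact_iff _).1 (P.exact_succ 0) u hu
      exact LinearMap.congr_fun (congrArg ModuleCat.Hom.hom hx) w)
  exact ⟨ModuleCat.ofHom y, ModuleCat.hom_ext hy⟩

/-- Over an infinite field, a divisor of a nonzero homogeneous polynomial that does not vanish at
the origin is a unit. -/
theorem MvPolynomial.IsHomogeneous.isUnit_of_dvd {σ K : Type*} [Field K] [Infinite K]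
    {p f : MvPolynomial σ K} {N : ℕ} (hf : f.IsHomogeneous N) (hf0 : f ≠ 0) (hp : p ∣ f)
    (hp0 : constantCoeff p ≠ 0) : IsUnit p := by
  suffices h : p = C (constantCoeff p) by
    rw [h]
    exact (isUnit_iff_ne_zero.2 hp0).map C
  refine sub_eq_zero.1 ((mul_eq_zero.1 ?_).resolve_left hf0)
  refine MvPolynomial.funext fun a => ?_
  rw [map_mul, map_sub, eval_C, map_zero, mul_eq_zero, or_iff_not_imp_left]
  intro hfa
  let φ : MvPolynomial σ K →ₐ[K] Polynomial K :=
    MvPolynomial.aeval fun s => Polynomial.X * Polynomial.C (a s)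
  have eval_φ (c : K) (q : MvPolynomial σ K) :
      (φ q).eval c = eval (fun s => c * a s) q := by
    induction q using MvPolynomial.induction_on with
    | C r => simp [φ, ← algebraMap_eq]
    | add p q hp hq => simp [hp, hq]
    | mul_X p s hp =>
      rw [map_mul, map_mul, Polynomial.eval_mul, hp]
      simp only [φ, MvPolynomial.aeval_X, eval_X, Polynomial.eval_mul,
        Polynomial.eval_X, Polynomial.eval_C]
  have hφf : φ f = Polynomial.C (eval a f) * Polynomial.X ^ N := by
    refine Polynomial.funext fun c => ?_
    rw [eval_φ]
    simp only [Polynomial.eval_mul, Polynomial.eval_C, Polynomial.eval_pow, Polynomial.eval_X]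
    rw [eval_eq, eval_eq, Finset.sum_mul]
    refine Finset.sum_congr rfl fun s hs => ?_
    simp only [mul_pow, Finset.prod_mul_distrib, Finset.prod_pow_eq_pow_sum]
    rw [← hf.degree_eq_sum_deg_support hs]
    ring
  have hdvd : φ p ∣ Polynomial.X ^ N := by
    have h := map_dvd φ hp
    rw [hφf] at h
    exact ((isUnit_iff_ne_zero.2 hfa).map Polynomial.C).dvd_mul_left.1 h
  obtain ⟨k, -, hk⟩ := (dvd_prime_pow Polynomial.prime_X N).1 hdvd
  have h0 : (φ p).eval 0 = constantCoeff p := by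
    simp only [eval_φ, zero_mul, eval_zero']
  have hk0 : k = 0 := by
    by_contra hk0
    have : Polynomial.X ∣ φ p := (dvd_pow_self _ hk0).trans hk.symm.dvd
    rw [Polynomial.X_dvd_iff, Polynomial.coeff_zero_eq_eval_zero, h0] at this
    exact hp0 this
  rw [hk0, pow_zero, associated_one_iff_isUnit] at hk
  obtain ⟨c, -, hc⟩ := Polynomial.isUnit_iff.1 hk
  have h1 := eval_φ 1 p
  rw [← hc] at h0 h1
  simp only [Polynomial.eval_C, one_mul] at h0 h1
  rw [← h1, ← h0, sub_self]

/-- The maximal minors of the generic matrix on the rows `0, …, n - 1` and `1, …, n` are relatively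
prime: a common divisor becomes a unit after specialising the generic matrix to a bidiagonal one
with indeterminates `t` and `s`, where the two minors become `t ^ n` and `s ^ n`. -/
theorem isRelPrime_det_submatrix_consecutive {K : Type*} [Field K] [Infinite K] {m n : ℕ}
    (u v : Fin n → Fin m) (hu : ∀ i, (u i : ℕ) = i) (hv : ∀ i, (v i : ℕ) = i + 1)
    (X : Matrix (Fin m) (Fin n) (MvPolynomial (Fin m × Fin n) K))
    (hX : ∀ i j, X i j = MvPolynomial.X (i, j)) :
    (X.submatrix u id).det ≠ 0 ∧ IsRelPrime (X.submatrix u id).det (X.submatrix v id).det := by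
  let φ : MvPolynomial (Fin m × Fin n) K →ₐ[K] MvPolynomial (Fin 2) K :=
    aeval fun q => if (q.1 : ℕ) = q.2 then MvPolynomial.X 0
      else if (q.1 : ℕ) = q.2 + 1 then MvPolynomial.X 1 else 0
  have hφu : φ (X.submatrix u id).det = MvPolynomial.X 0 ^ n := by
    rw [AlgHom.map_det, Matrix.det_of_isLowerTriangular]
    · simp [φ, hX, hu]
    · intro i j (hij : i < j)
      have : (i : ℕ) < j := hij
      simp [φ, hX, hu, show (i : ℕ) ≠ j by omega, show (i : ℕ) ≠ j + 1 by omega]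
  have hφv : φ (X.submatrix v id).det = MvPolynomial.X 1 ^ n := by
    rw [AlgHom.map_det, Matrix.det_of_isUpperTriangular]
    · simp [φ, hX, hv]
    · intro i j (hij : j < i)
      have : (j : ℕ) < i := hij
      simp [φ, hX, hv, show (i : ℕ) + 1 ≠ j by omega, show (i : ℕ) ≠ j by omega]
  have hu0 : (X.submatrix u id).det ≠ 0 := fun h => by
    rw [h, map_zero] at hφu
    exact pow_ne_zero n (X_ne_zero 0) hφu.symm
  refine ⟨hu0, fun p hpu hpv => ?_⟩
  have hhom : (X.submatrix u id).det.IsHomogeneous n := by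
    rw [Matrix.det_apply]
    refine IsHomogeneous.sum _ _ _ fun s _ => ?_
    have hprod := IsHomogeneous.prod Finset.univ (fun i => X.submatrix u id (s i) i) (fun _ => 1)
      (fun i _ => by simpa [hX] using isHomogeneous_X K _)
    rw [Finset.sum_const, Finset.card_univ, Fintype.card_fin, smul_eq_mul, mul_one] at hprod
    rcases Int.units_eq_one_or (Equiv.Perm.sign s) with hs | hs
    · rwa [hs, one_smul]
    · rw [hs, Units.neg_smul, one_smul]
      exact hprod.neg
  refine hhom.isUnit_of_dvd hu0 hpu fun hp0 => ?_
  have h0 := map_dvd φ hpu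
  have h1 := map_dvd φ hpv
  rw [hφu] at h0
  rw [hφv] at h1
  obtain ⟨k, -, hk⟩ := (dvd_prime_pow (X_prime (R := K) (i := (0 : Fin 2))) n).1 h0
  have hk0 : k = 0 := by
    by_contra hk0
    have := (X_prime (R := K) (i := (0 : Fin 2))).dvd_of_dvd_pow
      (((dvd_pow_self _ hk0).trans hk.symm.dvd).trans h1)
    simp [X_dvd_X] at this
  rw [hk0, pow_zero, associated_one_iff_isUnit] at hk
  have hc := hk.map (constantCoeff (R := K) (σ := Fin 2))
  have hcomp : (constantCoeff (R := K) (σ := Fin 2)).comp φ.toRingHom = constantCoeff := by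
    ext q
    · simp [φ]
    · simp only [RingHom.comp_apply, AlgHom.toRingHom_eq_coe, RingHom.coe_coe, φ, aeval_X]
      split_ifs <;> simp
  rw [show constantCoeff (φ p) = constantCoeff p from RingHom.congr_fun hcomp p, hp0] at hc
  exact not_isUnit_zero hc

/-- For `d ≥ 1`: every `S`-linear map `I^d → S` is multiplication by a unique element
of `S` (i.e. the natural map `S → Hom_S(I^d, S)` is bijective), and
`Ext^1_S(S/I^d, S) = 0`, where `I` is the ideal of maximal minors of the generic
`m × n` matrix. -/
theorem hom_powers_maximal_minors_and_ext_one
    (K : Type) [Field K] [CharZero K] (m n : ℕ) (hn : 1 ≤ n) (hmn : n < m)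
    (X : Matrix (Fin m) (Fin n) (MvPolynomial (Fin m × Fin n) K))
    (hX : ∀ i j, X i j = MvPolynomial.X (i, j))
    (I : Ideal (MvPolynomial (Fin m × Fin n) K))
    (hI : I = Ideal.span {p | ∃ g : Fin n → Fin m, StrictMono g ∧
      p = (X.submatrix g id).det})
    (d : ℕ) (hd : 1 ≤ d) :
    Function.Bijective (fun f : MvPolynomial (Fin m × Fin n) K =>
        (f • (I ^ d).subtype :
          ↥(I ^ d) →ₗ[MvPolynomial (Fin m × Fin n) K] MvPolynomial (Fin m × Fin n) K)) ∧
    Subsingleton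
      (((Ext (MvPolynomial (Fin m × Fin n) K) (ModuleCat (MvPolynomial (Fin m × Fin n) K)) 1).obj
          (Opposite.op (ModuleCat.of (MvPolynomial (Fin m × Fin n) K)
            (MvPolynomial (Fin m × Fin n) K ⧸ (I ^ d))))).obj
        (ModuleCat.of (MvPolynomial (Fin m × Fin n) K) (MvPolynomial (Fin m × Fin n) K))) := by
  let u : Fin n → Fin m := Fin.castLE hmn.le
  let v : Fin n → Fin m := fun i => ⟨i + 1, by omega⟩
  obtain ⟨hu0, huv⟩ := isRelPrime_det_submatrix_consecutive u v (fun _ => rfl) (fun _ => rfl) X hX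
  have hmem (g : Fin n → Fin m) (hg : StrictMono g) : (X.submatrix g id).det ^ d ∈ I ^ d :=
    Ideal.pow_mem_pow (hI ▸ Ideal.subset_span ⟨g, hg, rfl⟩) d
  have hu := hmem u (Fin.strictMono_castLE _)
  have hv := hmem v fun i j hij => Nat.succ_lt_succ hij
  have hann (c : MvPolynomial (Fin m × Fin n) K) (hc : c ∈ I ^ d)
      (z : MvPolynomial (Fin m × Fin n) K ⧸ (I ^ d)) : c • z = 0 := by
    obtain ⟨r, rfl⟩ := Ideal.Quotient.mk_surjective z
    exact Ideal.Quotient.eq_zero_iff_mem.2 (Ideal.mul_mem_right r _ hc)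
  exact ⟨Ideal.bijective_smul_subtype_of_isRelPrime (pow_ne_zero d hu0) huv.pow hu hv,
    subsingleton_ext_one_of_isRelPrime (pow_ne_zero d hu0) huv.pow _ (hann _ hu) (hann _ hv)⟩
end
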